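/- arXiv:2210.07831 — 4 statements merged into one kernel-verified Lean document; each statement's English description precedes it below -/
import Mathlib

section
/- There exists a finite colouring θ of ℕ (i.e. a function θ : ℕ → Fin r for some r ∈ ℕ) such that there is no injective sequence (x_n)_{n≥1} of natural numbers with the property that all the numbers x_n + x_m and x_n · x_m, for all pairs 1 ≤ n < m, have the same colour under θ. -/
/-- 2-adic valuation. -/
def V (n : ℕ) : ℕ := padicValNat 2 n

theorem V_rep (n : ℕ) (h : 0 < n) : ∃ q, n = 2 ^ V n * (2 * q + 1) := by
  obtain ⟨m, hm⟩ := (pow_padicValNat_dvd : 2 ^ padicValNat 2 n ∣ n)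
  rcases Nat.even_or_odd' m with ⟨q, hq | hq⟩
  · exfalso
    have : 2 ^ (padicValNat 2 n + 1) ∣ n := ⟨q, by rw [pow_succ, mul_assoc, ← hq]; exact hm⟩
    exact pow_succ_padicValNat_not_dvd h.ne' this
  · exact ⟨q, by rw [← hq]; exact hm⟩

theorem V_eq (k q : ℕ) : V (2 ^ k * (2 * q + 1)) = k := by
  unfold V
  rw [padicValNat.mul (by positivity) (by omega), padicValNat.prime_pow,
    padicValNat.eq_zero_of_not_dvd (by omega)]
  rfl

theorem V_mul (a b : ℕ) (ha : 0 < a) (hb : 0 < b) : V (a * b) = V a + V b :=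
  padicValNat.mul ha.ne' hb.ne'

theorem V_lt (a : ℕ) (ha : 0 < a) : 2 ^ V a ≤ a := Nat.le_of_dvd ha pow_padicValNat_dvd

theorem V_add_lt (a b : ℕ) (ha : 0 < a) (hb : 0 < b) (h : V a < V b) : V (a + b) = V a := by
  obtain ⟨p, hp⟩ := V_rep a ha
  obtain ⟨q, hq⟩ := V_rep b hb
  obtain ⟨d, hd⟩ := Nat.exists_eq_add_of_lt h
  have : a + b = 2 ^ V a * (2 * (p + 2 ^ d * (2 * q + 1)) + 1) := by
    conv_lhs => rw [hp, hq, hd]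
    ring
  rw [this, V_eq]

theorem V_add_eq (a b k : ℕ) (ha : 0 < a) (hb : 0 < b) (h1 : V a = k) (h2 : V b = k)
    (h : a % 2 ^ (k + 2) = b % 2 ^ (k + 2)) : V (a + b) = k + 1 := by
  obtain ⟨p, hp⟩ := V_rep a ha
  obtain ⟨q, hq⟩ := V_rep b hb
  rw [h1] at hp
  rw [h2] at hq
  have h4 : (2 * p + 1) % 4 = (2 * q + 1) % 4 := by
    rw [hp, hq, pow_add, Nat.mul_mod_mul_left, Nat.mul_mod_mul_left] at h
    exact Nat.eq_of_mul_eq_mul_left (by positivity) h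
  have : a + b = 2 ^ (k + 1) * (2 * ((p + q) / 2) + 1) := by
    have h5 : 2 * ((p + q) / 2) = p + q := by omega
    rw [h5, hp, hq]
    ring
  rw [this, V_eq]

theorem pigeon (S : Set ℕ) (f : ℕ → ℕ) (hS : S.Infinite) :
    (∃ k, {x ∈ S | f x = k}.Infinite) ∨ (∀ K, {x ∈ S | f x ≤ K}.Finite) := by
  by_cases h : ∃ k, {x ∈ S | f x = k}.Infinite
  · exact Or.inl h
  · right
    push Not at h
    intro K
    have := Set.Finite.biUnion (Set.finite_Iic K) (fun k _ => h k)
    refine this.subset ?_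
    intro x hx
    simp only [Set.mem_iUnion, Set.mem_Iic]
    exact ⟨f x, hx.2, hx.1, rfl⟩

theorem pigeon_mod (S : Set ℕ) (f : ℕ → ℕ) (hS : S.Infinite) (N : ℕ) (hN : 0 < N) :
    ∃ r, {x ∈ S | f x % N = r}.Infinite := by
  rcases pigeon S (fun x => f x % N) hS with h | h
  · exact h
  · exfalso
    apply hS
    refine (h N).subset fun x hx => ⟨hx, (Nat.mod_lt _ hN).le⟩

theorem big (S : Set ℕ) (hS : S.Infinite) (f g : ℕ → ℕ) (hf : ∀ K, {x ∈ S | f x ≤ K}.Finite)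
    (hg : ∀ K, {x ∈ S | g x ≤ K}.Finite) (K : ℕ) : ∃ x ∈ S, K < f x ∧ K < g x := by
  obtain ⟨x, hx, hx'⟩ := (hS.diff ((hf K).union (hg K))).nonempty
  refine ⟨x, hx, ?_, ?_⟩ <;> by_contra hc <;> apply hx'
  · exact Or.inl ⟨hx, by omega⟩
  · exact Or.inr ⟨hx, by omega⟩

theorem V_lt' (a : ℕ) (ha : 0 < a) : V a < a := lt_of_lt_of_le Nat.lt_two_pow_self (V_lt a ha)

theorem caseB (S : Set ℕ) (hS : S.Infinite) (hpos : ∀ x ∈ S, 0 < x)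
    (hV : ∀ K, {x ∈ S | V x ≤ K}.Finite) (L : ℕ → ℕ) (hL : ∀ x ∈ S, 0 < L x)
    (hsum : ∀ x ∈ S, ∀ y ∈ S, x < 2 ^ V y → L (x + y) = L y)
    (hprod : ∀ x ∈ S, ∀ y ∈ S, L (x * y) = L x + L y)
    (hc1 : ∀ x ∈ S, ∀ y ∈ S, x ≠ y → V (L (x + y)) % 2 = V (L (x * y)) % 2)
    (hc2 : ∀ x ∈ S, ∀ y ∈ S, x ≠ y →
      (V (x + y) < V (L (x + y)) ↔ V (x * y) < V (L (x * y)))) : False := by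
  rcases pigeon S (fun x => V (L x)) hS with ⟨k, hk⟩ | hk
  · obtain ⟨r, hr⟩ := pigeon_mod _ L hk (2 ^ (k + 2)) (by positivity)
    obtain ⟨x, ⟨hx, hxk⟩, hxr⟩ := hr.nonempty
    have hV' : ∀ K, {y ∈ {x ∈ {x ∈ S | V (L x) = k} | L x % 2 ^ (k + 2) = r} | V y ≤ K}.Finite :=
      fun K => (hV K).subset fun y hy => ⟨hy.1.1.1, hy.2⟩
    obtain ⟨y, ⟨⟨hy, hyk⟩, hyr⟩, hxy, -⟩ := big _ hr V V hV' hV' x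
    have hlt : x < 2 ^ V y := hxy.trans Nat.lt_two_pow_self
    have hne : x ≠ y := by
      rintro rfl
      have := V_lt' x (hpos x hx)
      omega
    have h1 := hc1 x hx y hy hne
    rw [hsum x hx y hy hlt, hprod x hx y hy,
      V_add_eq _ _ k (hL x hx) (hL y hy) hxk hyk (hxr.trans hyr.symm)] at h1
    omega
  · obtain ⟨x, hx⟩ := hS.nonempty
    obtain ⟨y, hy, h1, h2⟩ := big S hS V (fun x => V (L x)) hV hk (x + V (L x))
    have hVx := V_lt' x (hpos x hx)
    have hlt : x < 2 ^ V y := lt_trans (by omega) (Nat.lt_two_pow_self (n := V y))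
    have hne : x ≠ y := by
      rintro rfl
      omega
    have h := hc2 x hx y hy hne
    rw [hsum x hx y hy hlt, hprod x hx y hy, V_mul _ _ (hpos x hx) (hpos y hy),
      V_add_lt x y (hpos x hx) (hpos y hy) (by omega),
      V_add_lt (L x) (L y) (hL x hx) (hL y hy) (by omega)] at h
    have := h.1 (by omega)
    omega

theorem log_sum (x y : ℕ) (hy : 0 < y) (h : x < 2 ^ V y) :
    Nat.log 2 (x + y) = Nat.log 2 y := by
  set a := Nat.log 2 y with ha
  have h1 : 2 ^ a ≤ y := Nat.pow_log_le_self 2 hy.ne'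
  have h2 : y < 2 ^ (a + 1) := Nat.lt_pow_succ_log_self (by norm_num) y
  have h3 := V_lt y hy
  have h4 : V y < a + 1 := (Nat.pow_lt_pow_iff_right (by norm_num : 1 < 2)).1 (h3.trans_lt h2)
  obtain ⟨q, hq⟩ := V_rep y hy
  obtain ⟨d, hd⟩ := Nat.exists_eq_add_of_lt h4
  apply Nat.log_eq_of_pow_le_of_lt_pow
  · omega
  · have h5 : 2 ^ (a + 1) = 2 ^ V y * 2 ^ (d + 1) := by rw [hd]; ring
    rw [h5] at h2 ⊢
    have h6 : 2 * q + 1 < 2 ^ (d + 1) := by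
      apply lt_of_mul_lt_mul_left' (a := 2 ^ V y)
      rw [← hq]
      exact h2
    calc x + y < 2 ^ V y + 2 ^ V y * (2 * q + 1) := by omega
      _ = 2 ^ V y * (2 * q + 1 + 1) := by ring
      _ ≤ _ := Nat.mul_le_mul_left _ h6

/-- The odd part. -/
def O (n : ℕ) : ℕ := n / 2 ^ V n

theorem O_eq (k q : ℕ) : O (2 ^ k * (2 * q + 1)) = 2 * q + 1 := by
  unfold O
  rw [V_eq]
  exact Nat.mul_div_cancel_left _ (by positivity)

theorem two_inf (S : Set ℕ) (hS : S.Infinite) : ∃ x ∈ S, ∃ y ∈ S, x < y := by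
  obtain ⟨x, hx⟩ := hS.nonempty
  obtain ⟨y, hy, h⟩ := hS.exists_gt x
  exact ⟨x, hx, y, hy, h⟩

/-- Some pair in an infinite set has good valuation of the sum. -/
theorem good_pair (S : Set ℕ) (hS : S.Infinite) (w : ℕ → ℕ) (hw : ∀ x ∈ S, 0 < w x)
    (h4 : ∀ x ∈ S, 2 ≤ V (w x)) :
    ∃ x ∈ S, ∃ y ∈ S, x ≠ y ∧ V (w x + w y) < V (w x * w y) := by
  rcases pigeon S (fun x => V (w x)) hS with ⟨k, hk⟩ | hk
  · obtain ⟨r, hr⟩ := pigeon_mod _ w hk (2 ^ (k + 2)) (by positivity)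
    obtain ⟨x, ⟨⟨hx, hxk⟩, hxr⟩, y, ⟨⟨hy, hyk⟩, hyr⟩, hxy⟩ := two_inf _ hr
    refine ⟨x, hx, y, hy, hxy.ne, ?_⟩
    rw [V_add_eq _ _ k (hw x hx) (hw y hy) hxk hyk (hxr.trans hyr.symm),
      V_mul _ _ (hw x hx) (hw y hy)]
    have := h4 x hx
    omega
  · obtain ⟨x, hx⟩ := hS.nonempty
    obtain ⟨y, hy, h1, -⟩ := big S hS _ _ hk hk (V (w x))
    refine ⟨x, hx, y, hy, ?_, ?_⟩
    · rintro rfl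
      omega
    · rw [V_add_lt _ _ (hw x hx) (hw y hy) h1, V_mul _ _ (hw x hx) (hw y hy)]
      omega

theorem caseA (S : Set ℕ) (hS : S.Infinite) (hpos : ∀ x ∈ S, 0 < x) (v : ℕ)
    (hv : ∀ x ∈ S, V x = v)
    (hc1 : ∀ x ∈ S, ∀ y ∈ S, x ≠ y → V (Int.natAbs ((V (x + y) : ℤ) - 2)) % 2
      = V (Int.natAbs ((V (x * y) : ℤ) - 2)) % 2)
    (hc2 : ∀ x ∈ S, ∀ y ∈ S, x ≠ y → O (x + y) % 4 = O (x * y) % 4)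
    (hc3 : ∀ x ∈ S, ∀ y ∈ S, x ≠ y → V (O (x + y) - 1) % 2 = V (O (x * y) - 1) % 2) :
    False := by
  by_cases h1 : v = 1
  · subst h1
    obtain ⟨r, hr⟩ := pigeon_mod S id hS 16 (by norm_num)
    have hrep : ∀ x ∈ S, ∃ p, x = 4 * p + 2 := by
      intro x hx
      obtain ⟨p, hp⟩ := V_rep x (hpos x hx)
      rw [hv x hx] at hp
      exact ⟨p, by rw [hp]; ring⟩
    have key : ∀ p q, (4 * p + 2) % 16 = (4 * q + 2) % 16 →
        O (4 * p + 2 + (4 * q + 2)) = p + q + 1 ∧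
        O ((4 * p + 2) * (4 * q + 2)) = 4 * (p * q) + 2 * p + 2 * q + 1 := by
      intro p q hpq
      constructor
      · have : 4 * p + 2 + (4 * q + 2) = 2 ^ 2 * (2 * ((p + q) / 2) + 1) := by omega
        rw [this, O_eq]
        omega
      · have : (4 * p + 2) * (4 * q + 2) = 2 ^ 2 * (2 * (2 * (p * q) + p + q) + 1) := by ring
        rw [this, O_eq]
        ring
    obtain ⟨x0, ⟨hx0, hx0r⟩⟩ := hr.nonempty
    have hr4 : r % 4 = 2 ∧ r < 16 := by
      obtain ⟨p, hp⟩ := hrep x0 hx0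
      simp only [id] at hx0r
      omega
    by_cases h8 : r % 8 = 2
    · -- odd part is 1 mod 4
      have hr' := hr.diff (Set.finite_singleton 2)
      obtain ⟨x, ⟨⟨hx, hxr⟩, hx2⟩, y, ⟨⟨hy, hyr⟩, hy2⟩, hxy, hlt⟩ := good_pair _ hr'
        (fun x => x / 2 - 1) (by
          rintro x ⟨⟨hx, hxr⟩, hx2⟩
          simp only [id, Set.mem_singleton_iff] at hxr hx2
          have := hpos x hx
          omega) (by
          rintro x ⟨⟨hx, hxr⟩, hx2⟩
          simp only [id, Set.mem_singleton_iff] at hxr hx2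
          have := hpos x hx
          have h5 : x / 2 - 1 = 4 * ((x - 2) / 8) := by omega
          rw [h5, V_mul _ _ (by norm_num) (by omega)]
          have : V 4 = 2 := V_eq 2 0
          omega)
      obtain ⟨p, rfl⟩ := hrep x hx
      obtain ⟨q, rfl⟩ := hrep y hy
      have hc := hc3 _ hx _ hy hxy
      simp only [id, Set.mem_singleton_iff] at hxr hyr hx2 hy2
      rw [(key p q (hxr.trans hyr.symm)).1, (key p q (hxr.trans hyr.symm)).2] at hc
      have e1 : (4 * p + 2) / 2 - 1 = 2 * p := by omega
      have e2 : (4 * q + 2) / 2 - 1 = 2 * q := by omega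
      simp only [e1, e2] at hlt
      have e3 : 2 * p + 2 * q = 2 * (p + q) := by ring
      have e4 : V (2 * p + 2 * q) = V (p + q) + 1 := by
        rw [e3, V_mul _ _ (by norm_num) (by omega)]
        have : V 2 = 1 := V_eq 1 0
        omega
      have hp0 : 0 < p := by omega
      have hq0 : 0 < q := by omega
      have e5 : V (2 * p + 2 * q + 2 * p * (2 * q)) = V (2 * p + 2 * q) :=
        V_add_lt _ _ (by omega) (by positivity) hlt
      have e6 : 4 * (p * q) + 2 * p + 2 * q + 1 - 1 = 2 * p + 2 * q + 2 * p * (2 * q) := by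
        rw [Nat.add_sub_cancel]
        ring
      rw [e6, e5, e4, Nat.add_sub_cancel] at hc
      omega
    · obtain ⟨x, ⟨hx, hxr⟩, y, ⟨hy, hyr⟩, hxy⟩ := two_inf _ hr
      obtain ⟨p, rfl⟩ := hrep x hx
      obtain ⟨q, rfl⟩ := hrep y hy
      have hc := hc2 _ hx _ hy hxy.ne
      simp only [id] at hxr hyr
      rw [(key p q (hxr.trans hyr.symm)).1, (key p q (hxr.trans hyr.symm)).2] at hc
      omega
  · obtain ⟨r, hr⟩ := pigeon_mod S id hS (2 ^ (v + 2)) (by positivity)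
    obtain ⟨x, ⟨hx, hxr⟩, y, ⟨hy, hyr⟩, hxy⟩ := two_inf _ hr
    have hc := hc1 x hx y hy hxy.ne
    rw [V_add_eq x y v (hpos x hx) (hpos y hy) (hv x hx) (hv y hy) (hxr.trans hyr.symm),
      V_mul _ _ (hpos x hx) (hpos y hy), hv x hx, hv y hy] at hc
    have e : Int.natAbs (((v + v : ℕ) : ℤ) - 2) = 2 * Int.natAbs (((v + 1 : ℕ) : ℤ) - 2) := by
      omega
    rw [e, V_mul _ _ (by norm_num) (by omega)] at hc
    have : V 2 = 1 := V_eq 1 0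
    omega

/-- Reduction mod `n` as an element of `Fin`. -/
def md (n : ℕ) (k : ℕ) : Fin (n + 1) := ⟨k % (n + 1), Nat.mod_lt _ (by omega)⟩

theorem md_eq {n a b : ℕ} (h : md n a = md n b) : a % (n + 1) = b % (n + 1) :=
  congrArg Fin.val h

/-- The colouring. -/
def col (x : ℕ) : Fin 2 × Fin 4 × Fin 2 × Fin 2 × Fin 2 × Bool × Bool :=
  (md 1 (V (Int.natAbs ((V x : ℤ) - 2))), md 3 (O x), md 1 (V (O x - 1)),
    md 1 (V (Nat.log 2 x)), md 1 (V (Nat.log 2 x + 1)),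
    decide (V x < V (Nat.log 2 x)), decide (V x < V (Nat.log 2 x + 1)))

theorem no_mono_set (S : Set ℕ) (hS : S.Infinite) (hpos : ∀ x ∈ S, 0 < x)
    (hc : ∀ x ∈ S, ∀ y ∈ S, x ≠ y → col (x + y) = col (x * y)) : False := by
  simp only [col, Prod.mk.injEq, decide_eq_decide] at hc
  rcases pigeon S V hS with ⟨v, hv⟩ | hV
  · exact caseA _ hv (fun x hx => hpos x hx.1) v (fun x hx => hx.2)
      (fun x hx y hy h => md_eq (hc x hx.1 y hy.1 h).1)
      (fun x hx y hy h => md_eq (hc x hx.1 y hy.1 h).2.1)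
      (fun x hx y hy h => md_eq (hc x hx.1 y hy.1 h).2.2.1)
  · have lo : ∀ x, 0 < x → 2 ^ Nat.log 2 x ≤ x := fun x hx => Nat.pow_log_le_self 2 hx.ne'
    have hi : ∀ x, x < 2 ^ (Nat.log 2 x + 1) :=
      fun x => Nat.lt_pow_succ_log_self (by norm_num) x
    by_cases hm : {x ∈ S | 2 ^ (2 * Nat.log 2 x + 1) ≤ x ^ 2}.Infinite
    · refine caseB _ hm (fun x hx => hpos x hx.1)
        (fun K => (hV K).subset fun y hy => ⟨hy.1.1, hy.2⟩) (fun x => Nat.log 2 x + 1)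
        (fun x hx => by simp) ?_ ?_ 
        (fun x hx y hy h => md_eq (hc x hx.1 y hy.1 h).2.2.2.2.1)
        (fun x hx y hy h => (hc x hx.1 y hy.1 h).2.2.2.2.2.2)
      · intro x hx y hy h
        simp only [log_sum x y (hpos y hy.1) h]
      · intro x hx y hy
        have : Nat.log 2 (x * y) = Nat.log 2 x + Nat.log 2 y + 1 := by
          apply Nat.log_eq_of_pow_le_of_lt_pow
          · have := Nat.mul_le_mul hx.2 hy.2
            rw [← Nat.pow_le_pow_iff_left (n := 2) (by norm_num)]
            calc _ = _ := by ring
              _ ≤ _ := this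
              _ = _ := by ring
          · calc x * y < _ := Nat.mul_lt_mul'' (hi x) (hi y)
              _ = _ := by ring
        simp only [this]
        ring
    · rw [Set.not_infinite] at hm
      have hS2 := (hS.diff hm).diff (hV 0)
      refine caseB _ hS2 (fun x hx => hpos x hx.1.1)
        (fun K => (hV K).subset fun y hy => ⟨hy.1.1.1, hy.2⟩) (fun x => Nat.log 2 x)
        ?_ ?_ ?_ 
        (fun x hx y hy h => md_eq (hc x hx.1.1 y hy.1.1 h).2.2.2.1)
        (fun x hx y hy h => (hc x hx.1.1 y hy.1.1 h).2.2.2.2.2.1)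
      · rintro x ⟨⟨hx, -⟩, hx'⟩
        apply Nat.log_pos (by norm_num)
        have h1 := V_lt' x (hpos x hx)
        by_contra hcon
        exact hx' ⟨hx, by omega⟩
      · intro x hx y hy h
        simp only [log_sum x y (hpos y hy.1.1) h]
      · have hlt : ∀ x ∈ (S \ {x ∈ S | 2 ^ (2 * Nat.log 2 x + 1) ≤ x ^ 2}) \ {x ∈ S | V x ≤ 0},
            x ^ 2 < 2 ^ (2 * Nat.log 2 x + 1) := by
          rintro x ⟨⟨hx, hx'⟩, -⟩
          by_contra hcon
          exact hx' ⟨hx, by omega⟩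
        intro x hx y hy
        apply Nat.log_eq_of_pow_le_of_lt_pow
        · rw [pow_add]
          exact Nat.mul_le_mul (lo x (hpos x hx.1.1)) (lo y (hpos y hy.1.1))
        · have := Nat.mul_lt_mul'' (hlt x hx) (hlt y hy)
          rw [← Nat.pow_lt_pow_iff_left (n := 2) (by norm_num)]
          calc _ = _ := by ring
            _ < _ := this
            _ = _ := by ring

/-- There exists a finite colouring `θ` of the positive integers such that there is no
injective sequence `(x_n)` of positive integers with all the numbers `x_n + x_m` and
`x_n * x_m` (for `n < m`) of the same colour. -/
theorem stmt_4 :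
    ∃ (r : ℕ) (θ : ℕ → Fin r),
      ¬ ∃ (x : ℕ → ℕ) (c : Fin r),
        Function.Injective x ∧ (∀ n, 0 < x n) ∧
        (∀ n m, n < m → θ (x n + x m) = c ∧ θ (x n * x m) = c) := by
  refine ⟨_, fun n => Fintype.equivFin _ (col n), ?_⟩
  rintro ⟨x, c, hinj, hpos, h⟩
  refine no_mono_set (Set.range x) (Set.infinite_range_of_injective hinj) ?_ ?_
  · rintro _ ⟨n, rfl⟩
    exact hpos n
  · rintro _ ⟨n, rfl⟩ _ ⟨m, rfl⟩ hne
    rcases lt_trichotomy n m with hl | rfl | hl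
    · exact (Fintype.equivFin _).injective ((h n m hl).1.trans (h n m hl).2.symm)
    · exact absurd rfl hne
    · rw [add_comm, mul_comm]
      exact (Fintype.equivFin _).injective ((h m n hl).1.trans (h m n hl).2.symm)
end

section
/- There exists a finite colouring μ of the positive rationals ℚ⁺ with both of the following properties: (a) for every bounded injective sequence (x_n)_{n≥1} of positive rationals such that the set {x_n + x_m, x_n · x_m : n ≠ m} is monochromatic under μ, the set of primes dividing the denominators of the terms x_n is infinite; and (b) there exists an injective sequence (y_n)_{n≥1} of rationals in the open interval (0,1) such that the set of all its finite sums and all its finite products, namely {∑_{i∈F} y_i : F a finite nonempty set of indices} ∪ {∏_{i∈F} y_i : F a finite nonempty set of indices}, is monochromatic under μ. -/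
theorem s8_three_col {α : Type*} [DecidableEq α] (g : α → α) (n : ℕ) :
    ∀ S : Finset α, S.card = n → ∃ c : α → Fin 3, ∀ a ∈ S, g a ∈ S → g a ≠ a → c a ≠ c (g a) := by
  induction n with
  | zero =>
    intro S hS
    rw [Finset.card_eq_zero] at hS
    subst hS
    exact ⟨fun _ => 0, by simp⟩
  | succ n ih =>
    intro S hS
    have h1 : ∃ a ∈ S, (S.filter (fun b => g b = a)).card ≤ 1 := by
      by_contra! h
      have h2 : ∑ a ∈ S, (S.filter (fun b => g b = a)).card ≤ S.card := by
        rw [← Finset.card_biUnion]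
        · apply Finset.card_le_card
          intro b
          simp
        · intro a _ b _ hab
          rw [Function.onFun, Finset.disjoint_left]
          intro z hz hz'
          simp at hz hz'
          exact hab (hz.2.symm.trans hz'.2)
      have h3 : ∑ a ∈ S, 2 ≤ ∑ a ∈ S, (S.filter (fun b => g b = a)).card :=
        Finset.sum_le_sum (fun a ha => h a ha)
      simp at h3
      omega
    obtain ⟨a, ha, hcard⟩ := h1
    obtain ⟨c, hc⟩ := ih (S.erase a) (by rw [Finset.card_erase_of_mem ha]; omega)
    obtain ⟨b, hb⟩ : ∃ b, ∀ z ∈ S, g z = a → z = b := by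
      have hne : Nonempty α := ⟨a⟩
      have h := Finset.card_le_one_iff_subset_singleton (s := S.filter (fun b => g b = a))
      obtain ⟨b, hb⟩ := h.1 hcard
      refine ⟨b, fun z hz hz' => ?_⟩
      have := hb (Finset.mem_filter.2 ⟨hz, hz'⟩)
      simpa using this
    obtain ⟨d, hd1, hd2⟩ : ∃ d : Fin 3, d ≠ c (g a) ∧ d ≠ c b := by
      generalize c (g a) = u
      generalize c b = v
      revert u v
      decide
    refine ⟨Function.update c a d, fun z hz hgz hne => ?_⟩
    by_cases hza : z = a
    · subst hza
      rw [Function.update_self, Function.update_of_ne hne]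
      exact hd1
    · by_cases hgza : g z = a
      · have := hb z hz hgza
        rw [Function.update_of_ne hza, hgza, Function.update_self, this]
        exact hd2.symm
      · rw [Function.update_of_ne hza, Function.update_of_ne hgza]
        exact hc z (Finset.mem_erase.2 ⟨hza, hz⟩) (Finset.mem_erase.2 ⟨hgza, hgz⟩) hne

theorem s8_col (N : ℕ) : ∃ c : ZMod N → Fin 3, N ≠ 0 → ∀ a : ZMod N, a * a ≠ a → c a ≠ c (a * a) := by
  by_cases hN : N = 0
  · exact ⟨fun _ => 0, fun h => absurd hN h⟩
  · have : NeZero N := ⟨hN⟩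
    obtain ⟨c, hc⟩ := s8_three_col (fun a : ZMod N => a * a) _ Finset.univ rfl
    exact ⟨c, fun _ a ha => hc a (Finset.mem_univ _) (Finset.mem_univ _) ha⟩

/-- residue of a rational -/
noncomputable def s8rho (N : ℕ) (u : ℚ) : ZMod N := (u.num : ZMod N) * (u.den : ZMod N)⁻¹

theorem s8rho_den {N : ℕ} {u : ℚ} (h : u.den.Coprime N) : s8rho N u * u.den = u.num := by
  rw [s8rho, mul_assoc, ZMod.inv_mul_of_unit, mul_one]
  exact (ZMod.isUnit_iff_coprime _ _).2 h

theorem s8unit {N : ℕ} {u : ℚ} (h : u.den.Coprime N) : IsUnit (u.den : ZMod N) :=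
  (ZMod.isUnit_iff_coprime _ _).2 h

theorem s8cop_mul {N : ℕ} {u v : ℚ} (hu : u.den.Coprime N) (hv : v.den.Coprime N) :
    (u * v).den.Coprime N :=
  Nat.Coprime.coprime_dvd_left (Rat.mul_den_dvd u v) (Nat.Coprime.mul_left hu hv)

theorem s8cop_add {N : ℕ} {u v : ℚ} (hu : u.den.Coprime N) (hv : v.den.Coprime N) :
    (u + v).den.Coprime N :=
  Nat.Coprime.coprime_dvd_left (Rat.add_den_dvd u v) (Nat.Coprime.mul_left hu hv)

theorem s8rho_mul {N : ℕ} {u v : ℚ} (hu : u.den.Coprime N) (hv : v.den.Coprime N) :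
    s8rho N (u * v) = s8rho N u * s8rho N v := by
  have h1 := s8rho_den hu
  have h2 := s8rho_den hv
  have h3 := s8rho_den (s8cop_mul hu hv)
  have h4 := congrArg (fun z : ℤ => (z : ZMod N)) (Rat.mul_num_den' u v)
  push_cast at h4
  have hU := ((s8unit hu).mul (s8unit hv)).mul (s8unit (s8cop_mul hu hv))
  apply hU.mul_right_cancel
  rw [← h1, ← h2, ← h3] at h4
  linear_combination h4

theorem s8rho_add {N : ℕ} {u v : ℚ} (hu : u.den.Coprime N) (hv : v.den.Coprime N) :
    s8rho N (u + v) = s8rho N u + s8rho N v := by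
  have h1 := s8rho_den hu
  have h2 := s8rho_den hv
  have h3 := s8rho_den (s8cop_add hu hv)
  have h4 := congrArg (fun z : ℤ => (z : ZMod N)) (Rat.add_num_den' u v)
  push_cast at h4
  have hU := ((s8unit hu).mul (s8unit hv)).mul (s8unit (s8cop_add hu hv))
  apply hU.mul_right_cancel
  rw [← h1, ← h2, ← h3] at h4
  linear_combination h4

theorem s8rho_nat (N a : ℕ) : s8rho N (a : ℚ) = a := by
  simp [s8rho]

theorem s8rho_cast {N M : ℕ} (hNM : N ∣ M) {u : ℚ} (hu : u.den.Coprime M) :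
    ZMod.castHom hNM (ZMod N) (s8rho M u) = s8rho N u := by
  have hu' : u.den.Coprime N := Nat.Coprime.coprime_dvd_right hNM hu
  apply (s8unit hu').mul_right_cancel
  rw [s8rho_den hu']
  have := congrArg (ZMod.castHom hNM (ZMod N)) (s8rho_den hu)
  rw [map_mul, map_natCast, map_intCast] at this
  exact this

/-- arithmetic for the square case -/
theorem s8_arith {q J : ℕ} (hq : q.Prime) (hJ : 3 ≤ J) (A : ℤ) (h1 : (q : ℤ) ^ (J - 1) ∣ A - 1)
    (h2 : ¬ (q : ℤ) ^ J ∣ A - 1) (h3 : (q : ℤ) ^ J ∣ A * A - 1) :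
    ¬ (q : ℤ) ^ (J + 1) ∣ A * A - 1 := by
  obtain ⟨i, rfl⟩ : ∃ i, J = i + 3 := ⟨J - 3, by omega⟩
  have hqi : Prime (q : ℤ) := Nat.prime_iff_prime_int.1 hq
  have hq0 : (q : ℤ) ≠ 0 := hqi.ne_zero
  obtain ⟨w, hw⟩ := h1
  have e : i + 3 - 1 = i + 2 := by omega
  rw [e] at hw
  have hA : A = 1 + q ^ (i + 2) * w := by linarith
  have hqw : ¬ (q : ℤ) ∣ w := by
    rintro ⟨z, rfl⟩
    exact h2 ⟨z, by rw [hw]; ring⟩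
  have h4 : A * A - 1 = q ^ (i + 2) * (w * (2 + q ^ (i + 2) * w)) := by rw [hA]; ring
  have h5 : (q : ℤ) ∣ w * (2 + q ^ (i + 2) * w) := by
    rw [h4, pow_succ (q : ℤ) (i + 2)] at h3
    exact (mul_dvd_mul_iff_left (pow_ne_zero _ hq0)).1 h3
  have h6 : (q : ℤ) ∣ 2 := by
    have := (hqi.dvd_or_dvd h5).resolve_left hqw
    have h7 : (q : ℤ) ∣ q ^ (i + 2) * w := ⟨q ^ (i + 1) * w, by ring⟩
    exact (dvd_add_left h7).1 this
  have h8 : q = 2 := by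
    have : q ∣ 2 := by exact_mod_cast h6
    exact (Nat.prime_dvd_prime_iff_eq hq Nat.prime_two).1 this
  subst h8
  intro h9
  push_cast at *
  have h10 : A * A - 1 = 2 ^ (i + 3) * (w * (1 + 2 * (2 ^ i * w))) := by rw [hA]; ring
  rw [h10, pow_succ (2 : ℤ) (i + 3)] at h9
  have h11 := (mul_dvd_mul_iff_left (pow_ne_zero _ (by norm_num : (2 : ℤ) ≠ 0))).1 h9
  have := (Int.prime_two.dvd_or_dvd h11).resolve_left hqw
  omega

/-- real colour -/
noncomputable def s8kap (y : ℝ) : ZMod 4 := ((⌊2 * Real.logb 2 |y|⌋ : ℤ) : ZMod 4)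

theorem s8kap_ne {y : ℝ} (hy : y ≠ 0) :
    ∀ᶠ p : ℝ × ℝ in nhds (y, 2 * y), s8kap p.1 ≠ s8kap p.2 := by
  have hc : ∀ z : ℝ, z ≠ 0 → ContinuousAt (fun z => Real.logb 2 |z|) z := by
    intro z hz
    have : ContinuousAt (fun z => Real.log |z| / Real.log 2) z :=
      (continuous_abs.continuousAt.log (abs_ne_zero.2 hz)).div_const _
    exact this
  have h2 : Real.logb 2 |2 * y| = 1 + Real.logb 2 |y| := by
    rw [abs_mul, Real.logb_mul (by norm_num) (abs_ne_zero.2 hy)]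
    simp
  have e1 : ∀ᶠ z : ℝ in nhds y, dist (Real.logb 2 |z|) (Real.logb 2 |y|) < 1 / 4 := by
    exact Metric.tendsto_nhds.1 (hc y hy) (1 / 4) (by norm_num)
  have e2 : ∀ᶠ z : ℝ in nhds (2 * y), dist (Real.logb 2 |z|) (Real.logb 2 |2 * y|) < 1 / 4 := by
    exact Metric.tendsto_nhds.1 (hc (2 * y) (by positivity)) (1 / 4) (by norm_num)
  rw [nhds_prod_eq]
  filter_upwards [e1.prod_mk e2] with p hp heq
  obtain ⟨h3, h4⟩ := hp
  rw [h2] at h4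
  rw [Real.dist_eq, abs_lt] at h3 h4
  unfold s8kap at heq
  have h5 := (ZMod.intCast_eq_intCast_iff_dvd_sub _ _ 4).1 heq
  have f1 := Int.floor_le (2 * Real.logb 2 |p.1|)
  have f2 := Int.lt_floor_add_one (2 * Real.logb 2 |p.1|)
  have f3 := Int.floor_le (2 * Real.logb 2 |p.2|)
  have f4 := Int.lt_floor_add_one (2 * Real.logb 2 |p.2|)
  generalize ⌊2 * Real.logb 2 |p.1|⌋ = a at *
  generalize ⌊2 * Real.logb 2 |p.2|⌋ = b at *
  have g1 : (0 : ℝ) < ((b - a : ℤ) : ℝ) := by push_cast; linarith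
  have g2 : ((b - a : ℤ) : ℝ) < ((4 : ℤ) : ℝ) := by push_cast; linarith
  have g1' : 0 < b - a := by exact_mod_cast g1
  have g2' : b - a < 4 := by exact_mod_cast g2
  obtain ⟨z, hz⟩ := h5
  push_cast at hz
  omega

/-- dominant prime -/
def s8Dom (x : ℚ) (q k : ℕ) : Prop :=
  q.Prime ∧ 1 ≤ k ∧ padicValRat q x = -(k : ℤ) ∧
  (∀ p, p.Prime → -(k : ℤ) ≤ padicValRat p x) ∧ ∀ p, p.Prime → p < q → -(k : ℤ) < padicValRat p x

theorem s8Dom_unique {x : ℚ} {q k q' k' : ℕ} (h : s8Dom x q k) (h' : s8Dom x q' k') :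
    q = q' ∧ k = k' := by
  obtain ⟨a1, a2, a3, a4, a5⟩ := h
  obtain ⟨b1, b2, b3, b4, b5⟩ := h'
  have hk : k = k' := by
    have h1 := a4 q' b1
    have h2 := b4 q a1
    omega
  subst hk
  refine ⟨?_, rfl⟩
  rcases lt_trichotomy q q' with h | h | h
  · have := b5 q a1 h
    omega
  · exact h
  · have := a5 q' b1 h
    omega

theorem s8Dom_mul {x y : ℚ} {q k l : ℕ} (hx : x ≠ 0) (hy : y ≠ 0) (h : s8Dom x q k)
    (h' : s8Dom y q l) : s8Dom (x * y) q (k + l) := by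
  obtain ⟨a1, a2, a3, a4, a5⟩ := h
  obtain ⟨b1, b2, b3, b4, b5⟩ := h'
  refine ⟨a1, by omega, ?_, ?_, ?_⟩
  · have := Fact.mk a1
    rw [padicValRat.mul hx hy]
    omega
  · intro p hp
    have := Fact.mk hp
    rw [padicValRat.mul hx hy]
    have := a4 p hp
    have := b4 p hp
    omega
  · intro p hp hpq
    have := Fact.mk hp
    rw [padicValRat.mul hx hy]
    have := a5 p hp hpq
    have := b5 p hp hpq
    omega

theorem s8Dom_add {x y : ℚ} {q k l : ℕ} (hx : 0 < x) (hy : 0 < y) (h : s8Dom x q k)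
    (h' : s8Dom y q l) (hkl : k < l) : s8Dom (x + y) q l := by
  obtain ⟨a1, a2, a3, a4, a5⟩ := h
  obtain ⟨b1, b2, b3, b4, b5⟩ := h'
  have hxy : x + y ≠ 0 := (add_pos hx hy).ne'
  refine ⟨a1, by omega, ?_, ?_, ?_⟩
  · have := Fact.mk a1
    rw [add_comm] at hxy ⊢
    rw [padicValRat.add_eq_of_lt hxy hy.ne' hx.ne' (by omega)]
    exact b3
  · intro p hp
    have := Fact.mk hp
    have h1 := padicValRat.min_le_padicValRat_add (p := p) hxy
    have := a4 p hp
    have := b4 p hp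
    omega
  · intro p hp hpq
    have := Fact.mk hp
    have h1 := padicValRat.min_le_padicValRat_add (p := p) hxy
    have := a5 p hp hpq
    have := b5 p hp hpq
    omega

theorem s8_val_nonneg {p : ℕ} {x : ℚ} (h : ¬ p ∣ x.den) : 0 ≤ padicValRat p x := by
  rw [padicValRat, padicValNat.eq_zero_of_not_dvd h]
  simp

theorem s8_not_dvd {p : ℕ} (hp : p.Prime) {x : ℚ} (h : 0 ≤ padicValRat p x) : ¬ p ∣ x.den := by
  intro hd
  have := Fact.mk hp
  have h1 : 1 ≤ padicValNat p x.den := one_le_padicValNat_of_dvd x.den_nz hd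
  have h2 : padicValInt p x.num = 0 := by
    apply padicValInt.eq_zero_of_not_dvd
    intro h3
    have h4 : p ∣ x.num.natAbs := Int.natCast_dvd.1 h3
    have := Nat.dvd_gcd h4 hd
    rw [x.reduced] at this
    exact hp.one_lt.ne' (Nat.dvd_one.1 this)
  rw [padicValRat, h2] at h
  omega

theorem s8Dom_exists {x : ℚ} {p : ℕ} (hp : p.Prime) (h : padicValRat p x < 0) :
    ∃ q k, s8Dom x q k ∧ -(k : ℤ) ≤ padicValRat p x ∧ q ∣ x.den := by
  have hpS : p ∈ x.den.primeFactors := by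
    rw [Nat.mem_primeFactors]
    refine ⟨hp, ?_, x.den_nz⟩
    by_contra h'
    have := s8_val_nonneg h'
    omega
  obtain ⟨q, hqS, hq⟩ := Finset.exists_min_image x.den.primeFactors
    (fun r => toLex (padicValRat r x, r)) ⟨p, hpS⟩
  have hq' : ∀ r, r.Prime → padicValRat q x < padicValRat r x ∨
      (padicValRat q x = padicValRat r x ∧ q ≤ r) := by
    intro r hr
    by_cases hrS : r ∈ x.den.primeFactors
    · have := hq r hrS
      rw [Prod.Lex.le_iff] at this
      exact this
    · have h1 : 0 ≤ padicValRat r x := by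
        apply s8_val_nonneg
        intro h'
        exact hrS (Nat.mem_primeFactors.2 ⟨hr, h', x.den_nz⟩)
      have := hq p hpS
      rw [Prod.Lex.le_iff] at this
      simp at this
      omega
  have h0 := hq' p hp
  have hqp := (Nat.mem_primeFactors.1 hqS)
  refine ⟨q, (-padicValRat q x).toNat, ⟨hqp.1, by omega, by omega, ?_, ?_⟩, by omega, hqp.2.1⟩
  · intro r hr
    have := hq' r hr
    omega
  · intro r hr hrq
    have := hq' r hr
    omega

noncomputable def s8Q (x : ℚ) : ℕ × ℕ := Classical.epsilon (fun qk => s8Dom x qk.1 qk.2)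

theorem s8Q_eq {x : ℚ} {q k : ℕ} (h : s8Dom x q k) : s8Q x = (q, k) := by
  have h1 : s8Dom x (s8Q x).1 (s8Q x).2 :=
    Classical.epsilon_spec (p := fun qk : ℕ × ℕ => s8Dom x qk.1 qk.2) ⟨(q, k), h⟩
  have := s8Dom_unique h1 h
  exact Prod.ext this.1 this.2

noncomputable def s8U (x : ℚ) : ℚ := x * ((s8Q x).1 : ℚ) ^ (s8Q x).2

noncomputable def s8J (x : ℚ) : ℕ := sInf {J | s8rho ((s8Q x).1 ^ J) (s8U x) ≠ 1}

noncomputable def s8c (N : ℕ) : ZMod N → Fin 3 := (s8_col N).choose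

theorem s8c_ne {N : ℕ} (hN : N ≠ 0) {a : ZMod N} (ha : a * a ≠ a) : s8c N a ≠ s8c N (a * a) :=
  (s8_col N).choose_spec hN a ha

abbrev S8C : Type := ZMod 4 × ZMod 4 × Prop × Prop × Fin 4 × ZMod 2 × Fin 3

noncomputable def s8mu (x : ℚ) : S8C :=
  (s8kap (Real.logb 2 (x : ℝ) - 2), s8kap ((x : ℝ) - 4), s8U x = 1,
    s8rho ((s8Q x).1 ^ ⌊1 / x⌋₊) (s8U x) = 1, ⟨min (s8J x) 3, by omega⟩, (s8J x : ZMod 2),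
    s8c ((s8Q x).1 ^ s8J x) (s8rho ((s8Q x).1 ^ s8J x) (s8U x)))

theorem s8U_eq {x : ℚ} {q k : ℕ} (h : s8Dom x q k) : s8U x = x * (q : ℚ) ^ k := by
  rw [s8U, s8Q_eq h]

theorem s8val_U {x : ℚ} {q k : ℕ} (hx : x ≠ 0) (h : s8Dom x q k) :
    padicValRat q (x * (q : ℚ) ^ k) = 0 := by
  have := Fact.mk h.1
  have hq : (q : ℚ) ≠ 0 := by exact_mod_cast h.1.ne_zero
  rw [padicValRat.mul hx (pow_ne_zero _ hq), padicValRat.pow, padicValRat.self h.1.one_lt, h.2.2.1]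
  simp

theorem s8cop {q : ℕ} (hq : q.Prime) {u : ℚ} (h : padicValRat q u = 0) (J : ℕ) :
    u.den.Coprime (q ^ J) := by
  apply Nat.Coprime.pow_right
  exact ((Nat.Prime.coprime_iff_not_dvd hq).2 (s8_not_dvd hq h.ge)).symm

theorem s8rho_isUnit {q : ℕ} (hq : q.Prime) {u : ℚ} (h0 : u ≠ 0) (h : padicValRat q u = 0) (J : ℕ) :
    IsUnit (s8rho (q ^ J) u) := by
  have := Fact.mk hq
  have h1 : padicValRat q u⁻¹ = 0 := by rw [padicValRat.inv, h]; rfl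
  have h2 := s8rho_mul (s8cop hq h J) (s8cop hq h1 J)
  rw [mul_inv_cancel₀ h0] at h2
  have h3 := s8rho_nat (q ^ J) 1
  rw [Nat.cast_one, Nat.cast_one] at h3
  rw [h3] at h2
  exact IsUnit.of_mul_eq_one _ h2.symm

theorem s8rho_mono {q : ℕ} {u : ℚ} {i j : ℕ} (hij : i ≤ j)
    (h : u.den.Coprime (q ^ j)) (h1 : s8rho (q ^ j) u = 1) : s8rho (q ^ i) u = 1 := by
  rw [← s8rho_cast (pow_dvd_pow q hij) h, h1, map_one]

theorem s8rho_sum {x y : ℚ} {q k l J i : ℕ} (hx : x ≠ 0) (hy : y ≠ 0) (h : s8Dom x q k)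
    (h' : s8Dom y q l) (hkl : k + J ≤ l) (hi : i ≤ J) :
    s8rho (q ^ i) ((x + y) * (q : ℚ) ^ l) = s8rho (q ^ i) (y * (q : ℚ) ^ l) := by
  have e : (x + y) * (q : ℚ) ^ l = (x * (q : ℚ) ^ k) * ((q ^ (l - k) : ℕ) : ℚ) + y * (q : ℚ) ^ l := by
    have : (q : ℚ) ^ l = (q : ℚ) ^ k * (q : ℚ) ^ (l - k) := by rw [← pow_add]; congr 1; omega
    push_cast
    rw [add_mul, mul_assoc, ← this]
  have c1 := s8cop h.1 (s8val_U hx h) i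
  have c2 := s8cop h.1 (s8val_U hy h') i
  have c3 : ((q ^ (l - k) : ℕ) : ℚ).den.Coprime (q ^ i) := by rw [Rat.den_natCast]; simp
  rw [e, s8rho_add (s8cop_mul c1 c3) c2, s8rho_mul c1 c3, s8rho_nat]
  have : ((q ^ (l - k) : ℕ) : ZMod (q ^ i)) = 0 := by
    rw [ZMod.natCast_eq_zero_iff]
    exact pow_dvd_pow q (by omega)
  rw [this]
  simp

theorem s8rho_prod {x y : ℚ} {q k l i : ℕ} (hx : x ≠ 0) (hy : y ≠ 0) (h : s8Dom x q k)
    (h' : s8Dom y q l) :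
    s8rho (q ^ i) ((x * y) * (q : ℚ) ^ (k + l)) =
      s8rho (q ^ i) (x * (q : ℚ) ^ k) * s8rho (q ^ i) (y * (q : ℚ) ^ l) := by
  rw [← s8rho_mul (s8cop h.1 (s8val_U hx h) i) (s8cop h.1 (s8val_U hy h') i)]
  congr 1
  ring

theorem s8J_eq {x : ℚ} {q k J : ℕ} (hx : x ≠ 0) (h : s8Dom x q k) (hJ : 1 ≤ J)
    (h1 : s8rho (q ^ J) (x * (q : ℚ) ^ k) ≠ 1) (h2 : s8rho (q ^ (J - 1)) (x * (q : ℚ) ^ k) = 1) :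
    s8J x = J := by
  unfold s8J
  rw [s8U_eq h, s8Q_eq h]
  apply le_antisymm
  · exact Nat.sInf_le h1
  · by_contra! hlt
    have hm := Nat.sInf_mem (s := {J | s8rho (q ^ J) (x * (q : ℚ) ^ k) ≠ 1}) ⟨J, h1⟩
    exact hm (s8rho_mono (by dsimp only at hlt; omega) (s8cop h.1 (s8val_U hx h) _) h2)

theorem s8J_gt {x : ℚ} {q k J : ℕ} (hx : x ≠ 0) (h : s8Dom x q k)
    (h2 : s8rho (q ^ J) (x * (q : ℚ) ^ k) = 1) : s8J x = 0 ∨ J < s8J x := by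
  by_contra! hcon
  have hm : s8J x ∈ {J | s8rho ((s8Q x).1 ^ J) (s8U x) ≠ 1} := by
    apply Nat.sInf_mem
    by_contra h'
    rw [Set.not_nonempty_iff_eq_empty] at h'
    apply hcon.1
    rw [s8J, h', Nat.sInf_empty]
  rw [s8U_eq h, s8Q_eq h] at hm
  exact hm (s8rho_mono hcon.2 (s8cop h.1 (s8val_U hx h) _) h2)

theorem s8_int_one (N : ℕ) (A : ℤ) : (A : ZMod N) = 1 ↔ (N : ℤ) ∣ A - 1 := by
  rw [← ZMod.intCast_eq_intCast_iff_dvd_sub 1 A N]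
  push_cast
  exact eq_comm

theorem s8_exists_J {q : ℕ} (hq : q.Prime) {u : ℚ} (h : padicValRat q u = 0) (h1 : u ≠ 1) :
    ∃ J, s8rho (q ^ J) u ≠ 1 := by
  by_contra! hc
  set d : ℤ := u.num - u.den with hd
  have hd0 : d ≠ 0 := by
    intro h0
    apply h1
    rw [← Rat.num_div_den u]
    have h3 : u.num = u.den := by omega
    rw [h3]
    have := u.den_nz
    push_cast
    field_simp
  have h2 := s8rho_den (s8cop hq h d.natAbs)
  rw [hc, one_mul] at h2
  have h3 : ((d : ℤ) : ZMod (q ^ d.natAbs)) = 0 := by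
    rw [hd]
    push_cast
    rw [h2, sub_self]
  rw [ZMod.intCast_zmod_eq_zero_iff_dvd] at h3
  have h4 : q ^ d.natAbs ∣ d.natAbs := Int.natCast_dvd.1 h3
  have h5 := Nat.le_of_dvd (by omega) h4
  have h6 := Nat.lt_pow_self hq.one_lt (n := d.natAbs)
  omega

/-- finite level contradiction, case of nontrivial limit unit -/
theorem s8_case2 {x y : ℚ} {q k l J : ℕ} (hx : 0 < x) (hy : 0 < y) (h : s8Dom x q k)
    (h' : s8Dom y q l) (hJ : 1 ≤ J) (hkl : k + J ≤ l) (a : ZMod (q ^ (J + 1)))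
    (ha : s8rho (q ^ (J + 1)) (x * (q : ℚ) ^ k) = a)
    (ha' : s8rho (q ^ (J + 1)) (y * (q : ℚ) ^ l) = a)
    (h1 : s8rho (q ^ J) (x * (q : ℚ) ^ k) ≠ 1)
    (h2 : s8rho (q ^ (J - 1)) (x * (q : ℚ) ^ k) = 1)
    (hmu : s8mu (x + y) = s8mu (x * y)) : False := by
  have hq := h.1
  have vx := s8val_U hx.ne' h
  have vy := s8val_U hy.ne' h'
  have hqN : ∀ i, q ^ i ≠ 0 := fun i => pow_ne_zero _ hq.ne_zero
  have Ds : s8Dom (x + y) q l := s8Dom_add hx hy h h' (by omega)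
  have Dp : s8Dom (x * y) q (k + l) := s8Dom_mul hx.ne' hy.ne' h h'
  have hsx : ∀ i (hi : i ≤ J + 1), s8rho (q ^ i) (x * (q : ℚ) ^ k) =
      ZMod.castHom (pow_dvd_pow q hi) (ZMod (q ^ i)) a := by
    intro i hi
    rw [← ha, s8rho_cast _ (s8cop hq vx _)]
  have hsy : ∀ i (hi : i ≤ J + 1), s8rho (q ^ i) (y * (q : ℚ) ^ l) =
      ZMod.castHom (pow_dvd_pow q hi) (ZMod (q ^ i)) a := by
    intro i hi
    rw [← ha', s8rho_cast _ (s8cop hq vy _)]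
  have hxy : ∀ i, i ≤ J + 1 → s8rho (q ^ i) (y * (q : ℚ) ^ l) = s8rho (q ^ i) (x * (q : ℚ) ^ k) := by
    intro i hi
    rw [hsx i hi, hsy i hi]
  have hS : ∀ i, i ≤ J → s8rho (q ^ i) ((x + y) * (q : ℚ) ^ l) = s8rho (q ^ i) (x * (q : ℚ) ^ k) := by
    intro i hi
    rw [s8rho_sum hx.ne' hy.ne' h h' hkl hi, hxy i (by omega)]
  have hP : ∀ i, i ≤ J + 1 → s8rho (q ^ i) ((x * y) * (q : ℚ) ^ (k + l)) =
      s8rho (q ^ i) (x * (q : ℚ) ^ k) * s8rho (q ^ i) (x * (q : ℚ) ^ k) := by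
    intro i hi
    rw [s8rho_prod hx.ne' hy.ne' h h', hxy i hi]
  have JS : s8J (x + y) = J := s8J_eq (add_pos hx hy).ne' Ds hJ (by rw [hS J le_rfl]; exact h1)
    (by rw [hS _ (by omega)]; exact h2)
  simp only [s8mu, Prod.mk.injEq, Fin.mk.injEq] at hmu
  obtain ⟨-, -, -, -, m5, m6, m7⟩ := hmu
  by_cases hsq : s8rho (q ^ J) (x * (q : ℚ) ^ k) * s8rho (q ^ J) (x * (q : ℚ) ^ k) = 1
  · have hPJ : s8rho (q ^ J) ((x * y) * (q : ℚ) ^ (k + l)) = 1 := by rw [hP J (by omega), hsq]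
    by_cases hJ3 : 3 ≤ J
    · obtain ⟨A, hA⟩ := ZMod.intCast_surjective a
      have hAi : ∀ i (hi : i ≤ J + 1), s8rho (q ^ i) (x * (q : ℚ) ^ k) = ((A : ℤ) : ZMod (q ^ i)) := by
        intro i hi
        rw [hsx i hi, ← hA, map_intCast]
      have b1 := h2
      have b2 := h1
      have b3 := hsq
      rw [hAi _ (by omega), s8_int_one] at b1
      rw [hAi _ (by omega)] at b2 b3
      rw [Ne, s8_int_one] at b2
      rw [← Int.cast_mul, s8_int_one] at b3
      push_cast at b1 b2 b3
      have b4 := s8_arith hq hJ3 A b1 b2 b3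
      have JP : s8J (x * y) = J + 1 := by
        apply s8J_eq (mul_pos hx hy).ne' Dp (by omega)
        · rw [hP _ le_rfl, hAi _ le_rfl, ← Int.cast_mul, Ne, s8_int_one]
          push_cast
          exact b4
        · exact hPJ
      rw [JS, JP] at m6
      rw [ZMod.natCast_eq_natCast_iff] at m6
      have := m6.symm
      unfold Nat.ModEq at this
      omega
    · have := s8J_gt (mul_pos hx hy).ne' Dp hPJ
      rw [JS] at m5
      omega
  · have JP : s8J (x * y) = J := by
      apply s8J_eq (mul_pos hx hy).ne' Dp hJ
      · rw [hP _ (by omega)]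
        exact hsq
      · rw [hP _ (by omega), h2, one_mul]
    rw [JS, JP, s8U_eq Ds, s8U_eq Dp, s8Q_eq Ds, s8Q_eq Dp, hS J le_rfl, hP J (by omega)] at m7
    refine s8c_ne (hqN J) ?_ m7
    intro heq
    have hu := s8rho_isUnit hq (mul_ne_zero hx.ne'
      (pow_ne_zero _ (by exact_mod_cast hq.ne_zero))) vx J
    apply h1
    apply hu.mul_left_cancel
    rw [heq, mul_one]

/-- finite level contradiction, limit unit one but units not one -/
theorem s8_case1 {x y : ℚ} {q k l J : ℕ} (hx : 0 < x) (hy : 0 < y) (h : s8Dom x q k)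
    (h' : s8Dom y q l) (hkl : k + ⌊1 / x⌋₊ < l)
    (h1 : s8rho (q ^ J) (x * (q : ℚ) ^ k) ≠ 1)
    (h2 : s8rho (q ^ J) (y * (q : ℚ) ^ l) = 1)
    (h3 : s8rho (q ^ ⌊1 / x⌋₊) (y * (q : ℚ) ^ l) = 1)
    (h4 : (J : ℚ) ≤ 1 / (x * y))
    (hmu : s8mu (x + y) = s8mu (x * y)) : False := by
  have hq := h.1
  have vx := s8val_U hx.ne' h
  have vy := s8val_U hy.ne' h'
  have Ds : s8Dom (x + y) q l := s8Dom_add hx hy h h' (by omega)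
  have Dp : s8Dom (x * y) q (k + l) := s8Dom_mul hx.ne' hy.ne' h h'
  simp only [s8mu, Prod.mk.injEq] at hmu
  obtain ⟨-, -, -, m4, -⟩ := hmu
  rw [s8U_eq Ds, s8U_eq Dp, s8Q_eq Ds, s8Q_eq Dp] at m4
  have hT : ⌊1 / (x + y)⌋₊ ≤ ⌊1 / x⌋₊ := by
    apply Nat.floor_le_floor
    apply one_div_le_one_div_of_le hx
    linarith
  have e1 : s8rho (q ^ ⌊1 / (x + y)⌋₊) ((x + y) * (q : ℚ) ^ l) = 1 := by
    rw [s8rho_sum hx.ne' hy.ne' h h' hkl.le hT]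
    exact s8rho_mono hT (s8cop hq vy _) h3
  have e2 := m4.mp e1
  have hT2 : J ≤ ⌊1 / (x * y)⌋₊ := Nat.le_floor h4
  have e3 := s8rho_mono hT2 (s8cop hq (s8val_U (mul_pos hx hy).ne' Dp) _) e2
  rw [s8rho_prod hx.ne' hy.ne' h h', h2, mul_one] at e3
  exact h1 e3

/-- finite level contradiction, units one -/
theorem s8_case0 {x y : ℚ} {q k l : ℕ} (hx : 0 < x) (hy : 0 < y) (h : s8Dom x q k)
    (h' : s8Dom y q l) (hkl : k < l)
    (h1 : x * (q : ℚ) ^ k = 1) (h2 : y * (q : ℚ) ^ l = 1)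
    (hmu : s8mu (x + y) = s8mu (x * y)) : False := by
  have Ds : s8Dom (x + y) q l := s8Dom_add hx hy h h' (by omega)
  have Dp : s8Dom (x * y) q (k + l) := s8Dom_mul hx.ne' hy.ne' h h'
  simp only [s8mu, Prod.mk.injEq] at hmu
  obtain ⟨-, -, m3, -⟩ := hmu
  rw [s8U_eq Ds, s8U_eq Dp] at m3
  have e1 : (x * y) * (q : ℚ) ^ (k + l) = 1 := by
    rw [pow_add]
    linear_combination h1 * (y * (q : ℚ) ^ l) + h2
  have e2 := m3.mpr e1
  have hqp : (0 : ℚ) < (q : ℚ) := by exact_mod_cast h.1.pos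
  have : 0 < x * (q : ℚ) ^ l := by positivity
  rw [add_mul, h2] at e2
  linarith

open Filter Topology in
theorem s8_padic {U : Ultrafilter ℕ} (hU : ∀ n : ℕ, ∀ᶠ m in (U : Filter ℕ), n ≠ m)
    {x : ℕ → ℚ} (hpos : ∀ n, 0 < x n)
    (hlim : Tendsto (fun n => (x n : ℝ)) U (𝓝 0)) {q : ℕ} {k : ℕ → ℕ} (hq : q.Prime)
    (hD : ∀ᶠ n in (U : Filter ℕ), s8Dom (x n) q (k n))
    (hk : ∀ K : ℕ, ∀ᶠ n in (U : Filter ℕ), K ≤ k n)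
    (hmu : ∀ n m, n ≠ m → s8mu (x n + x m) = s8mu (x n * x m)) : False := by
  have hne : NeBot (U : Filter ℕ) := U.neBot
  by_cases hA : ∀ J, ∀ᶠ n in (U : Filter ℕ), s8rho (q ^ J) (x n * (q : ℚ) ^ k n) = 1
  · by_cases hB : ∀ᶠ n in (U : Filter ℕ), x n * (q : ℚ) ^ k n = 1
    · obtain ⟨n, hn1, hn2⟩ := (hD.and hB).exists
      obtain ⟨m, ⟨⟨hm1, hm2⟩, hm3⟩, hm4⟩ := (((hD.and hB).and (hk (k n + 1))).and (hU n)).exists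
      exact s8_case0 (hpos n) (hpos m) hn1 hm1 (by omega) hn2 hm2 (hmu n m hm4)
    · rw [← Ultrafilter.eventually_not] at hB
      obtain ⟨n, hn1, hn2⟩ := (hD.and hB).exists
      obtain ⟨J, hJ⟩ := s8_exists_J hq (s8val_U (hpos n).ne' hn1) hn2
      have hsmall : ∀ᶠ m in (U : Filter ℕ), (J : ℚ) ≤ 1 / (x n * x m) := by
        have hp : (0 : ℝ) < 1 / ((J + 1) * x n) := by
          have : (0 : ℝ) < x n := by exact_mod_cast hpos n
          positivity
        filter_upwards [hlim.eventually_lt_const hp] with m hm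
        have hm' : x m < 1 / ((J + 1) * x n) := by exact_mod_cast hm
        have hxn := hpos n
        have hxm := hpos m
        rw [lt_div_iff₀ (by positivity)] at hm'
        rw [le_div_iff₀ (by positivity)]
        have : 0 < x n * x m := by positivity
        nlinarith
      obtain ⟨m, hm1, hm2, hm3, hm4, hm5, hm6⟩ := (hD.and ((hA J).and ((hA ⌊1 / x n⌋₊).and
        ((hk (k n + ⌊1 / x n⌋₊ + 1)).and (hsmall.and (hU n)))))).exists
      exact s8_case1 (hpos n) (hpos m) hn1 hm1 (by omega) hJ hm2 hm3 hm5 (hmu n m hm6)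
  · push Not at hA
    classical
    have hA' : ∃ J, ¬ ∀ᶠ n in (U : Filter ℕ), s8rho (q ^ J) (x n * (q : ℚ) ^ k n) = 1 := by
      simpa using hA
    set J := Nat.find hA' with hJdef
    have hJ1 := Nat.find_spec hA'
    rw [← hJdef, ← Ultrafilter.eventually_not] at hJ1
    have hJpos : 1 ≤ J := by
      by_contra h0
      have h0' : J = 0 := by omega
      obtain ⟨n, hn⟩ := hJ1.exists
      apply hn
      rw [h0']
      have : Subsingleton (ZMod (q ^ 0)) := by
        rw [pow_zero]; infer_instance
      exact Subsingleton.elim _ _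
    have hJ2 : ∀ᶠ n in (U : Filter ℕ), s8rho (q ^ (J - 1)) (x n * (q : ℚ) ^ k n) = 1 := by
      have := Nat.find_min hA' (m := J - 1) (by omega)
      exact not_not.1 this
    obtain ⟨a, ha⟩ : ∃ a, ∀ᶠ n in (U : Filter ℕ), s8rho (q ^ (J + 1)) (x n * (q : ℚ) ^ k n) = a := by
      by_contra! hc
      have hNZ : NeZero (q ^ (J + 1)) := ⟨pow_ne_zero _ hq.ne_zero⟩
      have hc' : ∀ a, ∀ᶠ n in (U : Filter ℕ), ¬ s8rho (q ^ (J + 1)) (x n * (q : ℚ) ^ k n) = a := by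
        intro a
        rw [Ultrafilter.eventually_not]
        simpa using hc a
      obtain ⟨n, hn⟩ := (Filter.eventually_all.2 hc').exists
      exact hn _ rfl
    obtain ⟨n, hn1, hn2, hn3, hn4⟩ := (hD.and (ha.and (hJ1.and hJ2))).exists
    obtain ⟨m, hm1, hm2, hm3, hm4⟩ := (hD.and (ha.and ((hk (k n + J)).and (hU n)))).exists
    exact s8_case2 (hpos n) (hpos m) hn1 hm1 hJpos hm3 a hn2 hm2 hn3 hn4 (hmu n m hm4)

open Filter Topology in
theorem s8_real {U : Ultrafilter ℕ} (hU : ∀ n : ℕ, ∀ᶠ m in (U : Filter ℕ), n ≠ m)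
    {x : ℕ → ℚ} (hinj : Function.Injective x) {L : ℝ} (hL : 0 < L)
    (hlim : Tendsto (fun n => (x n : ℝ)) U (𝓝 L))
    (hmu : ∀ n m, n ≠ m → s8mu (x n + x m) = s8mu (x n * x m)) : False := by
  have hne : NeBot (U : Filter ℕ) := U.neBot
  by_cases hL2 : L = 2
  · subst hL2
    obtain ⟨n, hn⟩ : ∃ n, x n ≠ 2 := by
      by_contra! hc
      have := hinj ((hc 0).trans (hc 1).symm)
      omega
    have hn' : (x n : ℝ) - 2 ≠ 0 := by
      rw [sub_ne_zero]
      exact_mod_cast hn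
    have hcont : Tendsto (fun z : ℝ => ((x n : ℝ) + z - 4, (x n : ℝ) * z - 4)) (𝓝 2)
        (𝓝 ((x n : ℝ) - 2, 2 * ((x n : ℝ) - 2))) := by
      have : Continuous (fun z : ℝ => ((x n : ℝ) + z - 4, (x n : ℝ) * z - 4)) := by fun_prop
      convert this.tendsto 2 using 2
      ext <;> simp <;> ring
    have h1 := (hcont.comp hlim).eventually (s8kap_ne hn')
    obtain ⟨m, hm1, hm2⟩ := (h1.and (hU n)).exists
    have := hmu n m hm2
    simp only [s8mu, Prod.mk.injEq] at this
    apply hm1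
    have h2 := this.2.1
    push_cast at h2
    exact h2
  · have hs : Real.logb 2 (L / 2) ≠ 0 := by
      intro h0
      rw [Real.logb_eq_zero] at h0
      rcases h0 with h | h | h | h | h | h <;> first | (norm_num at h; done) | skip
      · linarith
      · apply hL2; linarith
      · linarith
    have hl2 : Real.logb 2 2 = 1 := by simp
    have hcont : Tendsto (fun z : ℝ × ℝ => (Real.logb 2 (z.1 + z.2) - 2, Real.logb 2 (z.1 * z.2) - 2))
        (𝓝 (L, L)) (𝓝 (Real.logb 2 (L / 2), 2 * Real.logb 2 (L / 2))) := by
      have c1 : ContinuousAt (fun z : ℝ × ℝ => Real.logb 2 (z.1 + z.2) - 2) (L, L) := by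
        have : ContinuousAt (fun z : ℝ × ℝ => Real.log (z.1 + z.2) / Real.log 2 - 2) (L, L) := by
          refine ContinuousAt.sub (ContinuousAt.div_const (ContinuousAt.log ?_ ?_) _) continuousAt_const
          · fun_prop
          · simp; positivity
        exact this
      have c2 : ContinuousAt (fun z : ℝ × ℝ => Real.logb 2 (z.1 * z.2) - 2) (L, L) := by
        have : ContinuousAt (fun z : ℝ × ℝ => Real.log (z.1 * z.2) / Real.log 2 - 2) (L, L) := by
          refine ContinuousAt.sub (ContinuousAt.div_const (ContinuousAt.log ?_ ?_) _) continuousAt_const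
          · fun_prop
          · simp; positivity
        exact this
      have c3 := c1.prodMk c2
      unfold ContinuousAt at c3
      have e1 : Real.logb 2 (L + L) - 2 = Real.logb 2 (L / 2) := by
        rw [← two_mul, Real.logb_mul (by norm_num) hL.ne', Real.logb_div hL.ne' (by norm_num), hl2]
        ring
      have e2 : Real.logb 2 (L * L) - 2 = 2 * Real.logb 2 (L / 2) := by
        rw [Real.logb_mul hL.ne' hL.ne', Real.logb_div hL.ne' (by norm_num), hl2]
        ring
      simp only [e1, e2] at c3
      exact c3
    have h1 := hcont.eventually (s8kap_ne hs)
    have h2 : Tendsto (fun p : ℕ × ℕ => ((x p.1 : ℝ), (x p.2 : ℝ))) ((U : Filter ℕ) ×ˢ (U : Filter ℕ))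
        (𝓝 (L, L)) := by
      rw [nhds_prod_eq]
      exact hlim.prodMap hlim
    have h3 := (h2.eventually h1).curry
    obtain ⟨n, hn⟩ := h3.exists
    obtain ⟨m, hm1, hm2⟩ := (hn.and (hU n)).exists
    have := hmu n m hm2
    simp only [s8mu, Prod.mk.injEq] at this
    apply hm1
    have h4 := this.1
    push_cast at h4
    exact h4

theorem s8_fin {x : ℕ → ℚ} (hinj : Function.Injective x) (hpos : ∀ n, 0 < x n) {C : ℚ}
    (hC : ∀ n, x n ≤ C) (hfin : {p : ℕ | p.Prime ∧ ∃ n, p ∣ (x n).den}.Finite) (K : ℕ) :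
    {n | ∀ p, p.Prime → -(K : ℤ) ≤ padicValRat p (x n)}.Finite := by
  set M : ℕ := ∏ p ∈ hfin.toFinset, p ^ K with hM
  have hM0 : M ≠ 0 := by
    rw [hM, Finset.prod_ne_zero_iff]
    intro p hp
    simp only [Set.Finite.mem_toFinset, Set.mem_ofPred_eq] at hp
    exact pow_ne_zero _ hp.1.ne_zero
  have hdvd : ∀ n, (∀ p, p.Prime → -(K : ℤ) ≤ padicValRat p (x n)) → (x n).den ∣ M := by
    intro n hn
    rw [← Nat.factorization_prime_le_iff_dvd (x n).den_nz hM0]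
    intro p hp
    by_cases hpd : p ∣ (x n).den
    · have hpM : p ^ K ∣ M := by
        apply Finset.dvd_prod_of_mem (fun p => p ^ K)
        simp only [Set.Finite.mem_toFinset, Set.mem_ofPred_eq]
        exact ⟨hp, n, hpd⟩
      have h1 := (hp.pow_dvd_iff_le_factorization hM0).1 hpM
      refine le_trans ?_ h1
      rw [Nat.factorization_def _ hp]
      have h2 : padicValInt p (x n).num = 0 := by
        apply padicValInt.eq_zero_of_not_dvd
        intro h3
        have h4 : p ∣ (x n).num.natAbs := Int.natCast_dvd.1 h3
        have := Nat.dvd_gcd h4 hpd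
        rw [(x n).reduced] at this
        exact hp.one_lt.ne' (Nat.dvd_one.1 this)
      have h5 := hn p hp
      rw [padicValRat, h2] at h5
      omega
    · rw [Nat.factorization_eq_zero_of_not_dvd hpd]
      exact Nat.zero_le _
  have hz : ∀ n, (x n).den ∣ M → ∃ z : ℤ, (z : ℚ) = x n * M := by
    intro n ⟨r, hr⟩
    refine ⟨(x n).num * r, ?_⟩
    rw [hr]
    push_cast
    rw [← mul_assoc, Rat.mul_den_eq_num]
  have hMp : (0 : ℚ) < M := by exact_mod_cast Nat.pos_of_ne_zero hM0
  apply Set.Finite.of_finite_image (f := fun n => x n) _ hinj.injOn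
  apply Set.Finite.subset ((Set.finite_Icc (0 : ℤ) ⌊C * M⌋).image (fun z : ℤ => (z : ℚ) / M))
  rintro _ ⟨n, hn, rfl⟩
  obtain ⟨z, hz⟩ := hz n (hdvd n hn)
  refine ⟨z, ⟨?_, ?_⟩, ?_⟩
  · have : (0 : ℚ) ≤ z := by rw [hz]; have := hpos n; positivity
    exact_mod_cast this
  · rw [Int.le_floor, hz]
    exact mul_le_mul_of_nonneg_right (hC n) hMp.le
  · simp only
    rw [hz]
    field_simp

open Filter Topology in
theorem s8_base {x : ℕ → ℚ} (hinj : Function.Injective x) (hpos : ∀ n, 0 < x n) {C : ℚ}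
    (hC : ∀ n, x n ≤ C) (hfin : {p : ℕ | p.Prime ∧ ∃ n, p ∣ (x n).den}.Finite)
    (hmu : ∀ n m, n ≠ m → s8mu (x n + x m) = s8mu (x n * x m)) : False := by
  set U : Ultrafilter ℕ := Filter.hyperfilter ℕ with hUdef
  have hne : NeBot (U : Filter ℕ) := U.neBot
  have hUfin : ∀ S : Set ℕ, S.Finite → ∀ᶠ n in (U : Filter ℕ), n ∉ S := by
    intro S hS
    exact hS.compl_mem_hyperfilter
  have hU : ∀ n : ℕ, ∀ᶠ m in (U : Filter ℕ), n ≠ m := by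
    intro n
    filter_upwards [hUfin {n} (Set.finite_singleton n)] with m hm h
    exact hm h.symm
  obtain ⟨L, hLm, hL⟩ := (isCompact_Icc (a := (0 : ℝ)) (b := (C : ℝ))).ultrafilter_le_nhds
    (U.map (fun n => (x n : ℝ))) (by
      rw [le_principal_iff]
      change ∀ᶠ n in (U : Filter ℕ), (x n : ℝ) ∈ Set.Icc (0 : ℝ) C
      apply Eventually.of_forall
      intro n
      exact ⟨by exact_mod_cast (hpos n).le, by exact_mod_cast hC n⟩)
  have hlim : Tendsto (fun n => (x n : ℝ)) U (𝓝 L) := hL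
  rcases hLm.1.eq_or_lt with h0 | h0
  · subst h0
    have hK : ∀ K : ℕ, ∀ᶠ n in (U : Filter ℕ), ∃ q k, s8Dom (x n) q k ∧ K ≤ k ∧ q ∣ (x n).den := by
      intro K
      filter_upwards [hUfin _ (s8_fin hinj hpos hC hfin K)] with n hn
      have hn : ¬ ∀ p, p.Prime → -(K : ℤ) ≤ padicValRat p (x n) := hn
      push Not at hn
      obtain ⟨p, hp, hn⟩ := hn
      obtain ⟨q, k, h1, h2, h3⟩ := s8Dom_exists (x := x n) hp (by omega)
      exact ⟨q, k, h1, by omega, h3⟩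
    obtain ⟨q, hq⟩ : ∃ q, ∀ᶠ n in (U : Filter ℕ), (s8Q (x n)).1 = q := by
      by_contra! hc
      have hc' : ∀ q ∈ hfin.toFinset, ∀ᶠ n in (U : Filter ℕ), ¬ (s8Q (x n)).1 = q := by
        intro q _
        rw [Ultrafilter.eventually_not]
        simpa using hc q
      obtain ⟨n, hn, q, k, h1, h2, h3⟩ := (((Filter.eventually_all_finset _).2 hc').and (hK 0)).exists
      refine hn q ?_ (by rw [s8Q_eq h1])
      simp only [Set.Finite.mem_toFinset, Set.mem_ofPred_eq]
      exact ⟨h1.1, n, h3⟩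
    have hDK : ∀ K : ℕ, ∀ᶠ n in (U : Filter ℕ), s8Dom (x n) q ((s8Q (x n)).2) ∧ K ≤ (s8Q (x n)).2 := by
      intro K
      filter_upwards [hq, hK K] with n hn hn'
      obtain ⟨q', k, h1, h2, -⟩ := hn'
      rw [s8Q_eq h1] at hn ⊢
      simp only at hn ⊢
      subst hn
      exact ⟨h1, h2⟩
    have hqp : q.Prime := by
      obtain ⟨n, hn⟩ := (hDK 0).exists
      exact hn.1.1
    exact s8_padic hU hpos hlim hqp ((hDK 0).mono fun n h => h.1)
      (fun K => (hDK K).mono fun n h => h.2) hmu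
  · exact s8_real hU hinj h0 hlim hmu

/-- the special sequence -/
noncomputable def s8y (i : ℕ) : ℚ := 1 / (Nat.nth Nat.Prime i : ℚ)

theorem s8p (i : ℕ) : (Nat.nth Nat.Prime i).Prime := Nat.prime_nth_prime i

theorem s8p_inj : Function.Injective (Nat.nth Nat.Prime) :=
  Nat.nth_injective Nat.infinite_setOfPred_prime

theorem s8y_den (i : ℕ) : (s8y i).den = Nat.nth Nat.Prime i := by
  rw [s8y, one_div, Rat.inv_natCast_den_of_pos (s8p i).pos]

theorem s8_sum_den (F : Finset ℕ) : (∑ i ∈ F, s8y i).den ∣ ∏ i ∈ F, Nat.nth Nat.Prime i := by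
  induction F using Finset.induction_on with
  | empty => simp
  | insert a s ha ih =>
    rw [Finset.sum_insert ha, Finset.prod_insert ha]
    refine (Rat.add_den_dvd _ _).trans ?_
    rw [s8y_den]
    exact mul_dvd_mul_left _ ih

theorem s8_not_dvd_prod {i : ℕ} {F : Finset ℕ} (hi : i ∉ F) :
    ¬ Nat.nth Nat.Prime i ∣ ∏ j ∈ F, Nat.nth Nat.Prime j := by
  intro h
  obtain ⟨j, hj, hd⟩ := (Prime.dvd_finsetProd_iff (s8p i).prime _).1 h
  have := s8p_inj ((Nat.prime_dvd_prime_iff_eq (s8p i) (s8p j)).1 hd)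
  subst this
  exact hi hj

theorem s8_dvd_sum {i : ℕ} {F : Finset ℕ} (hi : i ∈ F) :
    Nat.nth Nat.Prime i ∣ (∑ j ∈ F, s8y j).den := by
  have h1 : s8y i = (∑ j ∈ F, s8y j) + -(∑ j ∈ F.erase i, s8y j) := by
    rw [← Finset.add_sum_erase F _ hi]
    ring
  have h2 := Rat.add_den_dvd (∑ j ∈ F, s8y j) (-(∑ j ∈ F.erase i, s8y j))
  rw [← h1, s8y_den, Rat.neg_den] at h2
  refine ((s8p i).dvd_mul.1 h2).resolve_right fun h3 => ?_
  exact s8_not_dvd_prod (Finset.notMem_erase i F) (h3.trans (s8_sum_den _))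

theorem s8_dvd_prod {i : ℕ} {F : Finset ℕ} (hi : i ∈ F) :
    Nat.nth Nat.Prime i ∣ (∏ j ∈ F, s8y j).den := by
  have h1 : ∏ j ∈ F, s8y j = ((∏ j ∈ F, Nat.nth Nat.Prime j : ℕ) : ℚ)⁻¹ := by
    simp [s8y, Finset.prod_inv_distrib]
  rw [h1, Rat.inv_natCast_den_of_pos (Finset.prod_pos fun j _ => (s8p j).pos)]
  exact Finset.dvd_prod_of_mem _ hi

def s8Y : Set ℚ := {z | ∃ F : Finset ℕ, z = ∑ i ∈ F, s8y i ∨ z = ∏ i ∈ F, s8y i}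

theorem s8_special {x : ℕ → ℚ} (hinj : Function.Injective x)
    (hfin : {p : ℕ | p.Prime ∧ ∃ n, p ∣ (x n).den}.Finite)
    (h : ∀ n m, n ≠ m → x n + x m ∈ s8Y) : False := by
  classical
  have hI : {i | Nat.nth Nat.Prime i ∈ {p : ℕ | p.Prime ∧ ∃ n, p ∣ (x n).den}}.Finite :=
    hfin.preimage s8p_inj.injOn
  set I := hI.toFinset with hIdef
  have hfin2 : Set.Finite (((I.powerset.image fun F => ∑ i ∈ F, s8y i) ∪
    (I.powerset.image fun F => ∏ i ∈ F, s8y i) : Finset ℚ) : Set ℚ) := Finset.finite_toSet _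
  have hinj2 : Function.Injective (fun m => x 0 + x (m + 1)) := by
    intro a b hab
    have := hinj (add_left_cancel hab)
    omega
  apply Set.infinite_range_of_injective hinj2
  apply hfin2.subset
  rintro _ ⟨m, rfl⟩
  have hden : ∀ i, Nat.nth Nat.Prime i ∣ (x 0 + x (m + 1)).den → i ∈ I := by
    intro i hi
    rw [hIdef, Set.Finite.mem_toFinset]
    refine ⟨s8p i, ?_⟩
    rcases (s8p i).dvd_mul.1 (hi.trans (Rat.add_den_dvd _ _)) with h' | h'
    · exact ⟨_, h'⟩
    · exact ⟨_, h'⟩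
  obtain ⟨F, hF⟩ := h 0 (m + 1) (by omega)
  simp only [Finset.coe_union, Finset.coe_image, Set.mem_union, Set.mem_image, Finset.mem_coe,
    Finset.mem_powerset]
  rcases hF with hF | hF
  · left
    refine ⟨F, fun i hi => hden i ?_, hF.symm⟩
    rw [hF]
    exact s8_dvd_sum hi
  · right
    refine ⟨F, fun i hi => hden i ?_, hF.symm⟩
    rw [hF]
    exact s8_dvd_prod hi

theorem s8_exists_fintype : ∃ (α : Type) (_ : Fintype α) (ν : ℚ → α),
    (∀ (x : ℕ → ℚ),
        Function.Injective x → (∀ n, 0 < x n) → (∃ C : ℚ, ∀ n, x n ≤ C) →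
        (∃ c : α, ∀ n m, n ≠ m → ν (x n + x m) = c ∧ ν (x n * x m) = c) →
        {p : ℕ | p.Prime ∧ ∃ n, p ∣ (x n).den}.Infinite) ∧
      (∃ (y : ℕ → ℚ) (c : α),
        Function.Injective y ∧ (∀ n, 0 < y n ∧ y n < 1) ∧
        (∀ F : Finset ℕ, F.Nonempty →
          ν (∑ i ∈ F, y i) = c ∧ ν (∏ i ∈ F, y i) = c)) := by
  classical
  refine ⟨Option S8C, inferInstance, fun z => if z ∈ s8Y then none else some (s8mu z), ?_, ?_⟩
  · rintro x hinj hpos ⟨C, hC⟩ ⟨c, hc⟩ hfin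
    rcases c with _ | c
    · apply s8_special hinj hfin
      intro n m hnm
      by_contra hcon
      have := (hc n m hnm).1
      beta_reduce at this
      rw [if_neg hcon] at this
      exact Option.some_ne_none _ this
    · have key : ∀ z, (if z ∈ s8Y then none else some (s8mu z)) = some c → s8mu z = c := by
        intro z hz
        split_ifs at hz
        exact Option.some.inj hz
      apply s8_base hinj hpos hC hfin
      intro n m hnm
      rw [key _ (hc n m hnm).1, key _ (hc n m hnm).2]
  · refine ⟨s8y, none, ?_, ?_, ?_⟩
    · intro a b hab
      apply s8p_inj
      rw [← s8y_den, ← s8y_den, hab]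
    · intro n
      have h1 : (1 : ℚ) < Nat.nth Nat.Prime n := by exact_mod_cast (s8p n).one_lt
      refine ⟨by unfold s8y; positivity, ?_⟩
      rw [s8y, div_lt_one (by linarith)]
      exact h1
    · intro F _
      exact ⟨if_pos ⟨F, Or.inl rfl⟩, if_pos ⟨F, Or.inr rfl⟩⟩



/-- There exists a finite colouring `μ` of the positive rationals such that
(a) for every bounded injective sequence `(x_n)` of positive rationals with
`{x_n + x_m, x_n * x_m : n ≠ m}` monochromatic, the set of primes dividing the
denominators of the terms is infinite; and (b) there is an injective sequence `(y_n)`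
of rationals in `(0,1)` all of whose finite sums and finite products are monochromatic. -/
theorem stmt_8 :
    ∃ (r : ℕ) (μ : ℚ → Fin r),
      (∀ (x : ℕ → ℚ),
        Function.Injective x → (∀ n, 0 < x n) → (∃ C : ℚ, ∀ n, x n ≤ C) →
        (∃ c : Fin r, ∀ n m, n ≠ m → μ (x n + x m) = c ∧ μ (x n * x m) = c) →
        {p : ℕ | p.Prime ∧ ∃ n, p ∣ (x n).den}.Infinite) ∧
      (∃ (y : ℕ → ℚ) (c : Fin r),
        Function.Injective y ∧ (∀ n, 0 < y n ∧ y n < 1) ∧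
        (∀ F : Finset ℕ, F.Nonempty →
          μ (∑ i ∈ F, y i) = c ∧ μ (∏ i ∈ F, y i) = c)) := by
  obtain ⟨α, hα, ν, h1, y, c, hy1, hy2, hy3⟩ := s8_exists_fintype
  refine ⟨Fintype.card α, fun z => Fintype.equivFin α (ν z), ?_, y, Fintype.equivFin α c, hy1, hy2, ?_⟩
  · rintro x hinj hpos hC ⟨d, hd⟩
    refine h1 x hinj hpos hC ⟨(Fintype.equivFin α).symm d, fun n m hnm => ?_⟩
    have := hd n m hnm
    exact ⟨(Equiv.eq_symm_apply _).2 this.1, (Equiv.eq_symm_apply _).2 this.2⟩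
  · intro F hF
    have := hy3 F hF
    exact ⟨congrArg _ this.1, congrArg _ this.2⟩
end

section
/- There exists a finite colouring α of the positive rationals ℚ⁺ such that there is no unbounded injective sequence (x_n)_{n≥1} of positive rationals for which (i) the set of primes that divide the denominators (in lowest terms) of the terms x_n is finite, and (ii) the set of all finite sums and finite products of the sequence, namely {∑_{i∈F} x_i : F a finite nonempty set of indices} ∪ {∏_{i∈F} x_i : F a finite nonempty set of indices}, is monochromatic under α. -/
namespace FSP

open Filter Finset

lemma unbdd_sub (u : ℕ → ℝ) (h : ¬ ∃ C, ∀ n, u n ≤ C) :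
    ∃ φ : ℕ → ℕ, StrictMono φ ∧ Tendsto (u ∘ φ) atTop atTop := by
  have hf : ∀ n : ℕ, ∃ᶠ k in atTop, (n : ℝ) < u k := by
    intro n hn
    apply h
    have hn' : ∀ᶠ k in atTop, u k ≤ n := by
      filter_upwards [hn] with k hk using not_lt.1 hk
    obtain ⟨N, hN⟩ := eventually_atTop.1 hn'
    refine ⟨max n (∑ i ∈ range N, |u i|), fun k => ?_⟩
    by_cases hk : N ≤ k
    · exact le_max_of_le_left (hN k hk)
    · apply le_max_of_le_right
      calc u k ≤ |u k| := le_abs_self _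
        _ ≤ _ := Finset.single_le_sum (f := fun i => |u i|) (fun i _ => abs_nonneg _)
          (Finset.mem_range.2 (not_le.1 hk))
  obtain ⟨φ, hφ, hP⟩ := extraction_forall_of_frequently hf
  refine ⟨φ, hφ, ?_⟩
  exact tendsto_atTop_mono (fun n => (hP n).le) tendsto_natCast_atTop_atTop

lemma dvd_den_iff (p : ℕ) [hp : Fact p.Prime] (q : ℚ) :
    p ∣ q.den ↔ 1 < ‖(q : ℚ_[p])‖ := by
  constructor
  · intro h
    have h1 : ‖((q.den : ℕ) : ℚ_[p])‖ < 1 := Padic.norm_natCast_lt_one_iff.2 h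
    have h2 : ‖((q.num : ℤ) : ℚ_[p])‖ = 1 := by
      rw [Padic.norm_intCast_eq_one_iff]
      have := q.reduced
      rw [Int.isCoprime_iff_gcd_eq_one]
      have : Nat.Coprime q.num.natAbs p := Nat.Coprime.coprime_dvd_right h this
      simpa [Int.gcd] using this
    have h3 : (q : ℚ_[p]) * ((q.den : ℕ) : ℚ_[p]) = ((q.num : ℤ) : ℚ_[p]) := by
      have := Rat.mul_den_eq_num q
      exact_mod_cast congrArg (fun r : ℚ => (r : ℚ_[p])) this
    have h4 := congrArg norm h3
    rw [norm_mul, h2] at h4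
    by_contra hc
    push Not at hc
    nlinarith [norm_nonneg (q : ℚ_[p]), norm_nonneg ((q.den : ℕ) : ℚ_[p])]
  · intro h
    by_contra hc
    exact absurd (Padic.norm_rat_le_one hc) (not_le.2 h)

lemma prime_sub (p : ℕ) [hp : Fact p.Prime] (x : ℕ → ℚ) :
    ∃ φ : ℕ → ℕ, StrictMono φ ∧ ∃ b : ℕ, (b = 0 ∨ ∃ c, b = p ^ c) ∧
      ∀ F : Finset ℕ, F.Nonempty → (p ∣ (∑ i ∈ F, x (φ i)).den ↔ ¬ b ∣ F.card) := by
  by_cases hb : ∃ C : ℝ, ∀ n, ‖(x n : ℚ_[p])‖ ≤ C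
  · obtain ⟨C, hC⟩ := hb
    obtain ⟨L, -, φ, hφ, hL⟩ := tendsto_subseq_of_bounded
      (Metric.isBounded_closedBall (x := (0 : ℚ_[p])) (r := C)) (x := fun n => (x n : ℚ_[p]))
      (fun n => by simpa using hC n)
    have hev : ∀ᶠ n in atTop, ‖(x (φ n) : ℚ_[p]) - L‖ < 1 := by
      have := Metric.tendsto_nhds.1 hL 1 one_pos
      filter_upwards [this] with n hn
      simpa [dist_eq_norm] using hn
    obtain ⟨N, hN⟩ := eventually_atTop.1 hev
    have key : ∀ F : Finset ℕ, ‖(((∑ i ∈ F, x (φ (N + i)) : ℚ)) : ℚ_[p]) - (F.card : ℚ_[p]) * L‖ ≤ 1 := by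
      intro F
      have : (((∑ i ∈ F, x (φ (N + i)) : ℚ)) : ℚ_[p]) - (F.card : ℚ_[p]) * L
          = ∑ i ∈ F, ((x (φ (N + i)) : ℚ_[p]) - L) := by
        rw [Finset.sum_sub_distrib]; simp
      rw [this]
      exact IsUltrametricDist.norm_sum_le_of_forall_le_of_nonneg zero_le_one
        (fun i _ => (hN _ (by omega)).le)
    have key2 : ∀ F : Finset ℕ, (p ∣ (∑ i ∈ F, x (φ (N + i))).den ↔ ¬ ‖(F.card : ℚ_[p]) * L‖ ≤ 1) := by
      intro F
      rw [dvd_den_iff, ← not_le, not_iff_not]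
      have hk := key F
      set A := (((∑ i ∈ F, x (φ (N + i)) : ℚ)) : ℚ_[p])
      set B := (F.card : ℚ_[p]) * L
      constructor
      · intro h
        have := Padic.nonarchimedean A (-(A - B))
        rw [norm_neg] at this
        have e : A + -(A - B) = B := by ring
        rw [e] at this
        exact this.trans (max_le h hk)
      · intro h
        have := Padic.nonarchimedean (A - B) B
        rw [sub_add_cancel] at this
        exact this.trans (max_le hk h)
    refine ⟨fun i => φ (N + i), fun i j hij => hφ (by omega), ?_⟩
    by_cases hL1 : ‖L‖ ≤ 1
    · refine ⟨1, Or.inr ⟨0, by simp⟩, fun F _ => ?_⟩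
      rw [key2]
      have : ‖(F.card : ℚ_[p]) * L‖ ≤ 1 := by
        rw [norm_mul]
        have : ‖(F.card : ℚ_[p])‖ ≤ 1 := by exact_mod_cast Padic.norm_int_le_one (p := p) (F.card : ℤ)
        exact mul_le_one₀ this (norm_nonneg _) hL1
      exact iff_of_false (not_not.2 this) (by simp)
    · have hL0 : L ≠ 0 := by rintro rfl; simp at hL1
      have hv := Padic.norm_eq_zpow_neg_valuation hL0
      have hv0 : L.valuation < 0 := by
        by_contra hc
        exact hL1 ((Padic.norm_le_one_iff_val_nonneg L).2 (not_lt.1 hc))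
      obtain ⟨v, hvv⟩ : ∃ v : ℕ, L.valuation = -v := ⟨L.valuation.natAbs, by omega⟩
      refine ⟨p ^ v, Or.inr ⟨v, rfl⟩, fun F _ => ?_⟩
      rw [key2, not_iff_not]
      have h1 := Padic.norm_int_le_pow_iff_dvd (p := p) (F.card : ℤ) v
      have h2 : ((p ^ v : ℕ) : ℤ) ∣ (F.card : ℤ) ↔ p ^ v ∣ F.card := Int.natCast_dvd_natCast
      push_cast at h1 h2
      rw [← h2, ← h1, norm_mul, hv, hvv, neg_neg]
      have hp0 : (0 : ℝ) < (p : ℝ) ^ (v : ℤ) := by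
        have := hp.1.pos
        positivity
      rw [zpow_neg, ← one_div, le_div_iff₀ hp0]
  · obtain ⟨φ, hφ, ht⟩ := unbdd_sub _ hb
    have ht' : ∃ N, ∀ n ≥ N, 1 < ‖(x (φ n) : ℚ_[p])‖ :=
      eventually_atTop.1 (ht.eventually_gt_atTop 1)
    obtain ⟨N, hN⟩ := ht'
    have ht2 : Tendsto (fun n => ‖(x (φ (n + N)) : ℚ_[p])‖) atTop atTop :=
      ht.comp (tendsto_add_atTop_nat N)
    obtain ⟨ψ, hψ, hm⟩ := strictMono_subseq_of_tendsto_atTop ht2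
    refine ⟨fun i => φ (ψ i + N), fun i j hij => hφ (by have := hψ hij; omega), 0, Or.inl rfl, ?_⟩
    intro F hF
    have hc : ¬ 0 ∣ F.card := by simpa using hF.ne_empty
    simp only [hc, not_false_eq_true, iff_true]
    rw [dvd_den_iff]
    set M := F.max' hF
    have hMF : M ∈ F := F.max'_mem hF
    rw [← Finset.add_sum_erase F _ hMF]
    push_cast
    have hbig : 1 < ‖(x (φ (ψ M + N)) : ℚ_[p])‖ := hN _ (by omega)
    have hlt : ‖∑ i ∈ F.erase M, (x (φ (ψ i + N)) : ℚ_[p])‖ < ‖(x (φ (ψ M + N)) : ℚ_[p])‖ := by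
      by_cases he : (F.erase M).Nonempty
      · obtain ⟨j, hj, hle⟩ := IsUltrametricDist.exists_norm_finsetSum_le_of_nonempty he
          (fun i => (x (φ (ψ i + N)) : ℚ_[p]))
        refine hle.trans_lt (hm ?_)
        have hj' := Finset.mem_erase.1 hj
        exact lt_of_le_of_ne (F.le_max' j hj'.2) hj'.1
      · rw [Finset.not_nonempty_iff_eq_empty.1 he]
        rw [Finset.sum_empty, norm_zero]; linarith
    rw [Padic.add_eq_max_of_ne hlt.ne', max_eq_left hlt.le]
    exact hbig

lemma all_sub (P : Finset ℕ) (hP : ∀ p ∈ P, p.Prime) (x : ℕ → ℚ) :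
    ∃ φ : ℕ → ℕ, StrictMono φ ∧ ∃ b : ℕ → ℕ, ∀ p ∈ P, (b p = 0 ∨ ∃ c, b p = p ^ c) ∧
      ∀ F : Finset ℕ, F.Nonempty → (p ∣ (∑ i ∈ F, x (φ i)).den ↔ ¬ b p ∣ F.card) := by
  classical
  induction P using Finset.induction_on with
  | empty => exact ⟨id, strictMono_id, fun _ => 0, by simp⟩
  | insert q P hq ih =>
    obtain ⟨φ, hφ, b, hb⟩ := ih (fun p hp => hP p (Finset.mem_insert_of_mem hp))
    have : Fact q.Prime := ⟨hP q (Finset.mem_insert_self _ _)⟩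
    obtain ⟨ψ, hψ, b', hb', hF'⟩ := prime_sub q (fun n => x (φ n))
    refine ⟨fun n => φ (ψ n), hφ.comp hψ, fun p => if p = q then b' else b p, ?_⟩
    intro p hp
    by_cases hpq : p = q
    · subst hpq
      simp only [if_true]
      exact ⟨hb', hF'⟩
    · simp only [hpq, if_false]
      have hpP := (Finset.mem_insert.1 hp).resolve_left hpq
      refine ⟨(hb p hpP).1, fun F hF => ?_⟩
      have := (hb p hpP).2 (F.map ⟨ψ, hψ.injective⟩) (by simpa using hF)
      simpa using this

/-- all sums have the same set of primes in the denominator -/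
lemma primes_const (P : Finset ℕ) (hP : ∀ p ∈ P, p.Prime) (x : ℕ → ℚ) (b : ℕ → ℕ)
    (hx : ∀ n p, p.Prime → p ∣ (x n).den → p ∈ P)
    (hb : ∀ p ∈ P, (b p = 0 ∨ ∃ c, b p = p ^ c) ∧
      ∀ F : Finset ℕ, F.Nonempty → (p ∣ (∑ i ∈ F, x i).den ↔ ¬ b p ∣ F.card))
    (e : Prop) (he : ∀ F : Finset ℕ, F.Nonempty →
      (Even ((∑ i ∈ F, x i).den.primeFactors.card) ↔ e)) :
    ∃ Q : Finset ℕ, ∀ F : Finset ℕ, F.Nonempty → (∑ i ∈ F, x i).den.primeFactors = Q := by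
  classical
  have h1 : ∀ F : Finset ℕ, F.Nonempty →
      (∑ i ∈ F, x i).den.primeFactors = P.filter (fun p => ¬ b p ∣ F.card) := by
    intro F hF
    ext p
    simp only [Nat.mem_primeFactors, Finset.mem_filter]
    constructor
    · rintro ⟨hp, hd, -⟩
      have hpP : p ∈ P := by
        by_contra hn
        have : Fact p.Prime := ⟨hp⟩
        rw [dvd_den_iff] at hd
        push_cast at hd
        refine absurd hd (not_lt.2 ?_)
        refine IsUltrametricDist.norm_sum_le_of_forall_le_of_nonneg zero_le_one (fun i _ => ?_)
        exact Padic.norm_rat_le_one (fun hh => hn (hx i p hp hh))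
      exact ⟨hpP, ((hb p hpP).2 F hF).1 hd⟩
    · rintro ⟨hpP, hn⟩
      exact ⟨hP p hpP, ((hb p hpP).2 F hF).2 hn, Rat.den_ne_zero _⟩
  have h2 : ∀ p ∈ P, b p = 0 ∨ b p = 1 := by
    intro p hpP
    rcases (hb p hpP).1 with h | ⟨c, hc⟩
    · exact Or.inl h
    · rcases Nat.eq_zero_or_pos c with rfl | hcpos
      · right; simpa using hc
      exfalso
      have hpp := hP p hpP
      have hpc : 0 < p ^ c := pow_pos hpp.pos c
      have hF1 := he {0} (by simp)
      have hF2 := he (Finset.range (p ^ c)) (Finset.nonempty_range_iff.2 hpc.ne')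
      rw [h1 _ (by simp)] at hF1
      rw [h1 _ (Finset.nonempty_range_iff.2 hpc.ne')] at hF2
      have hins : P.filter (fun q => ¬ b q ∣ ({0} : Finset ℕ).card)
          = insert p (P.filter (fun q => ¬ b q ∣ (Finset.range (p ^ c)).card)) := by
        ext q
        simp only [Finset.mem_filter, Finset.mem_insert, Finset.card_singleton, Finset.card_range,
          Nat.dvd_one]
        constructor
        · rintro ⟨hq, hb1⟩
          by_cases hqp : q = p
          · exact Or.inl hqp
          · right
            refine ⟨hq, fun hd => ?_⟩
            rcases (hb q hq).1 with h | ⟨c', hc'⟩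
            · rw [h, Nat.zero_dvd] at hd; omega
            · rw [hc'] at hd hb1
              have hcop : Nat.Coprime (q ^ c') (p ^ c) :=
                Nat.Coprime.pow _ _ ((Nat.coprime_primes (hP q hq) hpp).2 hqp)
              exact hb1 (Nat.Coprime.eq_one_of_dvd hcop hd)
        · rintro (rfl | ⟨hq, hnd⟩)
          · refine ⟨hpP, ?_⟩
            rw [hc]
            exact (Nat.one_lt_pow hcpos.ne' hpp.one_lt).ne'
          · exact ⟨hq, fun h => hnd (by rw [h]; exact one_dvd _)⟩
      rw [hins, Finset.card_insert_of_notMem (by simp [hc]), Nat.even_add_one, hF2] at hF1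
      tauto
  refine ⟨P.filter (fun p => b p = 0), fun F hF => ?_⟩
  rw [h1 F hF]
  apply Finset.filter_congr
  intro p hp
  rcases h2 p hp with h | h
  · simp [h, hF.ne_empty]
  · simp [h]

/-- Divisibility lemma. -/
lemma div_lemma (R : ℕ) (hR : 2 ≤ R) (y : ℕ → ℤ) (e : Prop)
    (he : ∀ F : Finset ℕ, F.Nonempty → (Even (multiplicity (R : ℤ) (∑ i ∈ F, y i)) ↔ e)) (k : ℕ) :
    ∀ᶠ n in atTop, (R : ℤ) ^ k ∣ y n := by
  by_contra hcon
  have hfr : ∃ᶠ n in atTop, ¬ (R : ℤ) ^ k ∣ y n := not_eventually.1 hcon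
  have hinf : {n | ¬ (R : ℤ) ^ k ∣ y n}.Infinite := Nat.frequently_atTop_iff_infinite.1 hfr
  have : NeZero (R ^ (k + 1)) := ⟨by positivity⟩
  obtain ⟨n0, hn0, hS⟩ : ∃ n0, ¬ (R : ℤ) ^ k ∣ y n0 ∧
      {n | (R : ℤ) ^ (k + 1) ∣ y n - y n0}.Infinite := by
    by_contra hno
    push Not at hno
    apply hinf
    have hsub : {n | ¬ (R : ℤ) ^ k ∣ y n} ⊆ ⋃ r : ZMod (R ^ (k + 1)),
        {n | ¬ (R : ℤ) ^ k ∣ y n ∧ (y n : ZMod (R ^ (k + 1))) = r} := by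
      intro n hn
      exact Set.mem_iUnion.2 ⟨(y n : ZMod (R ^ (k + 1))), hn, rfl⟩
    refine Set.Finite.subset (Set.finite_iUnion fun r => ?_) hsub
    by_cases hne : {n | ¬ (R : ℤ) ^ k ∣ y n ∧ (y n : ZMod (R ^ (k + 1))) = r}.Nonempty
    · obtain ⟨n0, h0, h0r⟩ := hne
      refine (hno n0 h0).subset ?_
      rintro n ⟨_, hnr⟩
      have := (ZMod.intCast_eq_intCast_iff_dvd_sub (y n0) (y n) (R ^ (k + 1))).1 (h0r.trans hnr.symm)
      exact_mod_cast this
    · rw [Set.not_nonempty_iff_eq_empty.1 hne]; exact Set.finite_empty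
  obtain ⟨F, hFS, hFc⟩ := hS.exists_subset_card_eq R
  have hsum : (R : ℤ) ^ (k + 1) ∣ (∑ i ∈ F, y i) - R * y n0 := by
    have : (∑ i ∈ F, y i) - R * y n0 = ∑ i ∈ F, (y i - y n0) := by
      rw [Finset.sum_sub_distrib]; simp [hFc]
    rw [this]
    exact Finset.dvd_sum fun i hi => hFS hi
  have hR0 : (R : ℤ) ≠ 0 := by positivity
  have hy0 : y n0 ≠ 0 := fun h => hn0 (by rw [h]; exact dvd_zero _)
  have hfm : FiniteMultiplicity (R : ℤ) (y n0) := by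
    rw [Int.finiteMultiplicity_iff]
    exact ⟨by simp; omega, hy0⟩
  set j := multiplicity (R : ℤ) (y n0) with hj
  have hjd : (R : ℤ) ^ j ∣ y n0 := pow_multiplicity_dvd _ _
  have hjn : ¬ (R : ℤ) ^ (j + 1) ∣ y n0 := fun h => by
    have := hfm.le_multiplicity_of_pow_dvd h
    omega
  have hjk : j < k := by
    by_contra hc
    exact hn0 ((pow_dvd_pow _ (not_lt.1 hc)).trans hjd)
  have hm : multiplicity (R : ℤ) (∑ i ∈ F, y i) = j + 1 := by
    apply multiplicity_eq_of_dvd_of_not_dvd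
    · have h1 : (R : ℤ) ^ (j + 1) ∣ R * y n0 := by
        rw [pow_succ']; exact mul_dvd_mul_left _ hjd
      have h2 := (pow_dvd_pow (R : ℤ) (show j + 1 ≤ k + 1 by omega)).trans hsum
      exact (dvd_sub_left h1).1 h2
    · intro h
      have h2 := (pow_dvd_pow (R : ℤ) (show j + 1 + 1 ≤ k + 1 by omega)).trans hsum
      have h3 := (dvd_sub_right h).1 h2
      rw [pow_succ'] at h3
      exact hjn ((mul_dvd_mul_iff_left hR0).1 h3)
  have e1 := he {n0} (by simp)
  have e2 := he F (Finset.card_pos.1 (by omega))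
  rw [Finset.sum_singleton, ← hj] at e1
  rw [hm, Nat.even_add_one] at e2
  tauto

noncomputable def kk (t : ℝ) : ℤ := ⌊3 * t⌋

noncomputable def rnd (t : ℝ) : ℤ := (kk t + 1) / 3

lemma rnd_add (s t : ℝ) (r : ℤ) (hs : kk s % 3 = r) (ht : kk t % 3 = r)
    (hst : kk (s + t) % 3 = r) : rnd (s + t) = rnd s + rnd t ∧ r ≠ 1 := by
  have h1 : kk s + kk t ≤ kk (s + t) := by
    unfold kk; rw [mul_add]; exact Int.le_floor_add _ _
  have h2 : kk (s + t) ≤ kk s + kk t + 1 := by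
    unfold kk; rw [mul_add]
    have := Int.le_floor_add_floor (3 * s) (3 * t)
    omega
  unfold rnd
  omega

lemma rnd_sum (t : ℕ → ℝ) (r : ℤ) (h : ∀ F : Finset ℕ, F.Nonempty → kk (∑ i ∈ F, t i) % 3 = r)
    (F : Finset ℕ) (hF : F.Nonempty) : rnd (∑ i ∈ F, t i) = ∑ i ∈ F, rnd (t i) := by
  classical
  induction hF using Finset.Nonempty.cons_induction with
  | singleton a => simp
  | cons a s ha hs ih =>
    have h3 := h (Finset.cons a s ha) (by simp)
    have h1 := h {a} (by simp)
    rw [Finset.sum_cons] at h3 ⊢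
    rw [Finset.sum_singleton] at h1
    rw [(rnd_add _ _ r h1 (h s hs) h3).1, ih, Finset.sum_cons]

lemma rnd_ne_one (t : ℕ → ℝ) (r : ℤ)
    (h : ∀ F : Finset ℕ, F.Nonempty → kk (∑ i ∈ F, t i) % 3 = r) : r ≠ 1 := by
  have h0 := h {0} (by simp)
  have h1 := h {1} (by simp)
  have h2 := h {0, 1} (by simp)
  rw [Finset.sum_pair (by norm_num)] at h2
  rw [Finset.sum_singleton] at h0 h1
  exact (rnd_add _ _ r h0 h1 h2).2

noncomputable def del (t : ℝ) : ℝ := t - rnd t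

lemma del_zero (t : ℝ) (h : kk t % 3 = 0) : 0 ≤ del t ∧ del t ≤ 1 / 3 := by
  have h1 : (kk t : ℝ) ≤ 3 * t := Int.floor_le _
  have h2 : 3 * t < kk t + 1 := Int.lt_floor_add_one _
  have h3 : kk t = 3 * rnd t := by unfold rnd; omega
  have h4 : (kk t : ℝ) = 3 * rnd t := by exact_mod_cast h3
  unfold del
  constructor <;> linarith

lemma del_two (t : ℝ) (h : kk t % 3 = 2) : del t < 0 ∧ -(1 / 3) ≤ del t := by
  have h1 : (kk t : ℝ) ≤ 3 * t := Int.floor_le _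
  have h2 : 3 * t < kk t + 1 := Int.lt_floor_add_one _
  have h3 : kk t + 1 = 3 * rnd t := by unfold rnd; omega
  have h4 : (kk t : ℝ) + 1 = 3 * rnd t := by exact_mod_cast h3
  unfold del
  constructor <;> linarith

/-- `|del|` tends to zero, and `|del|` is additive -/
lemma del_tendsto (t : ℕ → ℝ) (r : ℤ)
    (h : ∀ F : Finset ℕ, F.Nonempty → kk (∑ i ∈ F, t i) % 3 = r) :
    Tendsto (fun n => |del (t n)|) atTop (nhds 0) ∧
    ∀ m, m ≠ 0 → |del (t 0)| ≤ |del (t 0 + t m)| := by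
  have hr := rnd_ne_one t r h
  have hadd : ∀ F : Finset ℕ, F.Nonempty → del (∑ i ∈ F, t i) = ∑ i ∈ F, del (t i) := by
    intro F hF
    unfold del
    rw [rnd_sum t r h F hF, Finset.sum_sub_distrib]
    push_cast; rfl
  have h1 : ∀ n, kk (t n) % 3 = r := fun n => by simpa using h {n} (by simp)
  have hr' : r = 0 ∨ r = 2 := by have := h1 0; omega
  have habs : ∀ F : Finset ℕ, F.Nonempty → |del (∑ i ∈ F, t i)| = ∑ i ∈ F, |del (t i)| := by
    intro F hF
    rw [hadd F hF]
    rcases hr' with rfl | rfl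
    · exact (Finset.abs_sum_of_nonneg (fun i _ => (del_zero _ (h1 i)).1)).trans
        (Finset.sum_congr rfl fun i _ => (abs_of_nonneg (del_zero _ (h1 i)).1).symm)
    · rw [← abs_neg, ← Finset.sum_neg_distrib, Finset.abs_sum_of_nonneg]
      · exact Finset.sum_congr rfl fun i _ => (abs_of_neg (del_two _ (h1 i)).1).symm
      · intro i _
        have := (del_two _ (h1 i)).1
        linarith
  constructor
  · have hs : Summable (fun n => |del (t n)|) := by
      refine summable_of_sum_le (c := 1 / 3) (fun _ => abs_nonneg _) (fun F => ?_)
      rcases F.eq_empty_or_nonempty with rfl | hF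
      · simp
      · rw [← habs F hF]
        have hk := h F hF
        rcases hr' with rfl | rfl
        · have := del_zero _ hk
          rw [abs_of_nonneg this.1]; exact this.2
        · have := del_two _ hk
          rw [abs_of_neg this.1]; linarith
    exact hs.tendsto_atTop_zero
  · intro m hm
    have := habs {0, m} (by simp)
    rw [Finset.sum_pair hm.symm, Finset.sum_pair hm.symm] at this
    rw [this]
    have := abs_nonneg (del (t m))
    linarith

lemma rnd_int_add (z : ℤ) (t : ℝ) (ht : |t| < 1 / 3) : rnd (z + t) = z := by
  have h := abs_lt.1 ht
  have h1 : kk (z + t) = 3 * z + ⌊3 * t⌋ := by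
    unfold kk
    rw [mul_add, show (3 : ℝ) * z = ((3 * z : ℤ) : ℝ) by push_cast; ring, Int.floor_intCast_add]
  have h2 : -1 ≤ ⌊3 * t⌋ := by rw [Int.le_floor]; push_cast; linarith
  have h3 : ⌊3 * t⌋ < 1 := by rw [Int.floor_lt]; push_cast; linarith
  unfold rnd
  omega

lemma del_int_add (z : ℤ) (t : ℝ) (ht : |t| < 1 / 3) : del (z + t) = t := by
  unfold del; rw [rnd_int_add z t ht]; ring

lemma rnd_same (s t : ℝ) (hst : s ≤ t) (hts : t ≤ s + 1 / 3) (h : kk s % 3 = kk t % 3) :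
    rnd t = rnd s := by
  have h1 : kk s ≤ kk t := Int.floor_le_floor (by linarith)
  have h2 : kk t ≤ kk s + 1 := by
    unfold kk
    have : 3 * t ≤ 3 * s + 1 := by linarith
    exact (Int.floor_le_floor this).trans (by rw [Int.floor_add_one])
  unfold rnd
  omega

lemma mult_add (R a b : ℤ) (hf : FiniteMultiplicity R a) (hb : R ^ (multiplicity R a + 1) ∣ b) :
    multiplicity R (a + b) = multiplicity R a := by
  apply multiplicity_eq_of_dvd_of_not_dvd
  · exact dvd_add (pow_multiplicity_dvd _ _) ((pow_dvd_pow _ (Nat.le_succ _)).trans hb)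
  · intro h
    have h2 := (dvd_add_left hb).1 h
    have := hf.le_multiplicity_of_pow_dvd h2
    omega

lemma fin2 (a : ℤ) (h : a ≠ 0) : FiniteMultiplicity (2 : ℤ) a := by
  rw [Int.finiteMultiplicity_iff]
  exact ⟨by norm_num, h⟩

lemma dvd_rad_pow (n : ℕ) (hn : n ≠ 0) : n ∣ (∏ p ∈ n.primeFactors, p) ^ n := by
  conv_lhs => rw [← Nat.prod_factorization_pow_eq_self hn]
  rw [← Finset.prod_pow]
  exact Finset.prod_dvd_prod_of_dvd _ _ fun p _ =>
    pow_dvd_pow _ (Nat.factorization_lt p hn).le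

noncomputable def Rad (x : ℚ) : ℕ := if x.den = 1 then 2 else ∏ p ∈ x.den.primeFactors, p

noncomputable def aa (x : ℚ) : ℤ := rnd (Real.logb 2 (x : ℝ))

noncomputable def gg (x : ℚ) : ℝ :=
  if x.den = 1 then (multiplicity (2 : ℤ) x.num : ℝ) else 1 / |del (x : ℝ)|

lemma aa_pos (x : ℚ) (hx : 2 ≤ x) : 0 < aa x := by
  have hx' : (2 : ℝ) ≤ x := by exact_mod_cast hx
  have h1 : 1 ≤ Real.logb 2 (x : ℝ) := by
    rw [Real.le_logb_iff_rpow_le (by norm_num) (by linarith)]; simpa using hx'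
  have h2 : 3 ≤ kk (Real.logb 2 (x : ℝ)) := by
    unfold kk; rw [Int.le_floor]; push_cast; linarith
  unfold aa rnd
  omega

lemma rnd_int (z : ℤ) : rnd (z : ℝ) = z := by
  have := rnd_int_add z 0 (by norm_num)
  simpa using this

lemma num_of_den (x : ℚ) (h : x.den = 1) : x = (x.num : ℚ) := (Rat.den_eq_one_iff x).1 h |>.symm

lemma den_one_of_del (x : ℚ) (h : del (x : ℝ) = 0) : x.den = 1 := by
  unfold del at h
  have h1 : (x : ℝ) = ((rnd (x : ℝ) : ℤ) : ℝ) := by linarith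
  have h2 : x = ((rnd (x : ℝ) : ℤ) : ℚ) := by exact_mod_cast h1
  rw [h2]; simp

lemma del_of_den_one (x : ℚ) (h : x.den = 1) : del (x : ℝ) = 0 := by
  have h1 : (x : ℝ) = ((x.num : ℤ) : ℝ) := by
    conv_lhs => rw [num_of_den x h]
    simp
  unfold del
  rw [h1, rnd_int]; ring

lemma core (x : ℕ → ℚ) (hx2 : ∀ n, 2 ≤ x n) (hlim : Tendsto (fun n => (x n : ℝ)) atTop atTop)
    (Q : Finset ℕ) (hQ : ∀ F : Finset ℕ, F.Nonempty → (∑ i ∈ F, x i).den.primeFactors = Q)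
    (r1 r2 : ℤ) (e4 e5 e6 : Prop)
    (h1 : ∀ F : Finset ℕ, F.Nonempty → kk ((∑ i ∈ F, x i : ℚ) : ℝ) % 3 = r1)
    (h2s : ∀ F : Finset ℕ, F.Nonempty → kk (Real.logb 2 ((∑ i ∈ F, x i : ℚ) : ℝ)) % 3 = r2)
    (h2p : ∀ F : Finset ℕ, F.Nonempty → kk (Real.logb 2 ((∏ i ∈ F, x i : ℚ) : ℝ)) % 3 = r2)
    (h4 : ∀ F : Finset ℕ, F.Nonempty → (Even (multiplicity ((Rad (∑ i ∈ F, x i) : ℕ) : ℤ)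
      (rnd ((∑ i ∈ F, x i : ℚ) : ℝ))) ↔ e4))
    (h5 : ∀ F : Finset ℕ, F.Nonempty → (Even (multiplicity (2 : ℤ) (aa (∏ i ∈ F, x i))) ↔ e5))
    (h6s : ∀ F : Finset ℕ, F.Nonempty →
      (gg (∑ i ∈ F, x i) ≤ (multiplicity (2 : ℤ) (aa (∑ i ∈ F, x i)) : ℝ) ↔ e6))
    (h6p : ∀ F : Finset ℕ, F.Nonempty →
      (gg (∏ i ∈ F, x i) ≤ (multiplicity (2 : ℤ) (aa (∏ i ∈ F, x i)) : ℝ) ↔ e6)) : False := by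
  have hx2' : ∀ n, (2 : ℝ) ≤ x n := fun n => by exact_mod_cast hx2 n
  -- divisibility of the exponents
  have hlogF : ∀ F : Finset ℕ, Real.logb 2 ((∏ i ∈ F, x i : ℚ) : ℝ)
      = ∑ i ∈ F, Real.logb 2 (x i : ℝ) := by
    intro F
    push_cast
    exact Real.logb_prod _ _ (fun i _ => by have := hx2' i; positivity)
  have h2p' : ∀ F : Finset ℕ, F.Nonempty → kk (∑ i ∈ F, Real.logb 2 (x i : ℝ)) % 3 = r2 := by
    intro F hF; rw [← hlogF]; exact h2p F hF
  have haF : ∀ F : Finset ℕ, F.Nonempty → aa (∏ i ∈ F, x i) = ∑ i ∈ F, aa (x i) := by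
    intro F hF
    unfold aa
    rw [hlogF, rnd_sum _ r2 h2p' F hF]
  have hA : ∀ k : ℕ, ∀ᶠ n in atTop, (2 : ℤ) ^ k ∣ aa (x n) := by
    refine div_lemma 2 le_rfl (fun n => aa (x n)) e5 ?_
    intro F hF
    rw [← haF F hF]; exact h5 F hF
  -- divisibility of the integer parts
  have h1' : ∀ F : Finset ℕ, F.Nonempty → kk (∑ i ∈ F, (x i : ℝ)) % 3 = r1 := by
    intro F hF; have := h1 F hF; push_cast at this; exact this
  set R : ℕ := if Q = ∅ then 2 else ∏ p ∈ Q, p with hRdef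
  have hden : ∀ F : Finset ℕ, F.Nonempty → ((∑ i ∈ F, x i).den = 1 ↔ Q = ∅) := by
    intro F hF
    rw [← hQ F hF, Nat.primeFactors_eq_empty]
    have := Rat.den_ne_zero (∑ i ∈ F, x i)
    tauto
  have hRad : ∀ F : Finset ℕ, F.Nonempty → Rad (∑ i ∈ F, x i) = R := by
    intro F hF
    unfold Rad
    rw [hQ F hF, hRdef]
    simp only [hden F hF]
  have hR2 : 2 ≤ R := by
    rw [hRdef]
    split_ifs with hq
    · exact le_rfl
    · obtain ⟨p, hp⟩ := Finset.nonempty_iff_ne_empty.2 hq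
      have hprime : ∀ q ∈ Q, q.Prime := by
        intro q hq
        rw [← hQ {0} (by simp)] at hq
        exact Nat.prime_of_mem_primeFactors hq
      calc 2 ≤ p := (hprime p hp).two_le
        _ ≤ _ := Nat.le_of_dvd (Finset.prod_pos fun q hq => (hprime q hq).pos)
          (Finset.dvd_prod_of_mem _ hp)
  have hN : ∀ k : ℕ, ∀ᶠ n in atTop, (R : ℤ) ^ k ∣ rnd (x n : ℝ) := by
    refine div_lemma R hR2 (fun n => rnd (x n : ℝ)) e4 ?_
    intro F hF
    have := h4 F hF
    rw [hRad F hF] at this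
    push_cast at this
    rw [rnd_sum _ r1 h1' F hF] at this
    exact this
  have hdenn : ∀ n, ((x n).den = 1 ↔ Q = ∅) := fun n => by simpa using hden {n} (by simp)
  obtain ⟨hdel, hdelge⟩ := del_tendsto _ r1 h1'
  have hmne : ∀ᶠ m : ℕ in atTop, m ≠ 0 := eventually_ne_atTop 0
  -- sums
  have hgs : ∃ C : ℕ, ∀ᶠ m in atTop, gg (x 0 + x m) ≤ C := by
    by_cases hq : Q = ∅
    · refine ⟨multiplicity (2 : ℤ) (x 0).num, ?_⟩
      filter_upwards [hN (multiplicity (2 : ℤ) (x 0).num + 1)] with m hm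
      have e0 := num_of_den _ ((hdenn 0).2 hq)
      have em := num_of_den _ ((hdenn m).2 hq)
      have es : x 0 + x m = (((x 0).num + (x m).num : ℤ) : ℚ) := by
        push_cast; rw [← e0, ← em]
      have hr : rnd (x m : ℝ) = (x m).num := by
        have : (x m : ℝ) = (((x m).num : ℤ) : ℝ) := by exact_mod_cast congrArg (fun q : ℚ => (q : ℝ)) em
        rw [this, rnd_int]
      have hR : R = 2 := by rw [hRdef, if_pos hq]
      rw [hr, hR] at hm
      have hnz : (x 0).num ≠ 0 := by
        have := hx2 0
        rw [Ne, Rat.num_eq_zero]; positivity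
      unfold gg
      rw [es, Rat.den_intCast, if_pos rfl, Rat.num_intCast, mult_add _ _ _ (fin2 _ hnz) (by exact_mod_cast hm)]
    · obtain ⟨C, hC⟩ := exists_nat_ge (1 / |del (x 0 : ℝ)|)
      refine ⟨C, ?_⟩
      filter_upwards [hmne] with m hm
      have hd := hden {0, m} (by simp)
      rw [Finset.sum_pair hm.symm] at hd
      unfold gg
      rw [if_neg (fun h => hq (hd.1 h))]
      refine le_trans ?_ hC
      have hpos : 0 < |del (x 0 : ℝ)| := by
        rw [abs_pos]
        exact fun h => hq ((hdenn 0).1 (den_one_of_del _ h))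
      have := hdelge m hm
      push_cast
      exact one_div_le_one_div_of_le hpos this
  obtain ⟨C, hC⟩ := hgs
  have has : ∀ᶠ m in atTop, m ≠ 0 → aa (x 0 + x m) = aa (x m) := by
    filter_upwards [hlim.eventually_ge_atTop (4 * (x 0 : ℝ))] with m hm hm0
    unfold aa
    have p0 := hx2' 0
    have pm := hx2' m
    apply rnd_same
    · push_cast
      exact Real.logb_le_logb_of_le (by norm_num) (by linarith) (by linarith)
    · have hb : Real.logb 2 (5 / 4 : ℝ) ≤ 1 / 3 := by
        have : (3 : ℕ) * Real.logb 2 (5 / 4 : ℝ) ≤ 1 := by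
          rw [← Real.logb_pow, Real.logb_le_iff_le_rpow (by norm_num) (by norm_num)]
          norm_num
        push_cast at this
        linarith
      have : Real.logb 2 (((x 0 + x m : ℚ)) : ℝ) ≤ Real.logb 2 ((x m : ℝ) * (5 / 4)) := by
        push_cast
        exact Real.logb_le_logb_of_le (by norm_num) (by linarith) (by linarith)
      rw [Real.logb_mul (by positivity) (by norm_num)] at this
      linarith
    · have ha := h2s {m} (by simp)
      have hb := h2s {0, m} (by simp)
      rw [Finset.sum_singleton] at ha
      rw [Finset.sum_pair hm0.symm] at hb
      rw [ha, hb]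
  have he6 : e6 := by
    obtain ⟨m, h1, h2, h3, h4⟩ := (hC.and (has.and (hmne.and (hA C)))).exists
    have := h6s {0, m} (by simp)
    rw [Finset.sum_pair h3.symm] at this
    rw [← this, h2 h3]
    refine h1.trans ?_
    exact_mod_cast (fin2 _ (aa_pos _ (hx2 m)).ne').le_multiplicity_of_pow_dvd h4
  -- products
  set j := multiplicity (2 : ℤ) (aa (x 0)) with hj
  have hgp : ∀ᶠ m in atTop, (j : ℝ) < gg (x 0 * x m) := by
    by_cases hq : Q = ∅
    · filter_upwards [hN (j + 1)] with m hm
      have e0 := num_of_den _ ((hdenn 0).2 hq)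
      have em := num_of_den _ ((hdenn m).2 hq)
      have es : x 0 * x m = (((x 0).num * (x m).num : ℤ) : ℚ) := by
        push_cast; rw [← e0, ← em]
      have hr : rnd (x m : ℝ) = (x m).num := by
        have : (x m : ℝ) = (((x m).num : ℤ) : ℝ) := by exact_mod_cast congrArg (fun q : ℚ => (q : ℝ)) em
        rw [this, rnd_int]
      have hR : R = 2 := by rw [hRdef, if_pos hq]
      rw [hr, hR] at hm
      have hnz : ∀ n, (x n).num ≠ 0 := by
        intro n
        have := hx2 n
        rw [Ne, Rat.num_eq_zero]; positivity
      unfold gg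
      rw [es, Rat.den_intCast, if_pos rfl, Rat.num_intCast]
      have := (fin2 _ (mul_ne_zero (hnz 0) (hnz m))).le_multiplicity_of_pow_dvd
        (k := j + 1) (Dvd.dvd.mul_left (by exact_mod_cast hm) _)
      exact_mod_cast this
    · have hlim0 : Tendsto (fun m => (x 0 : ℝ) * |del (x m : ℝ)|) atTop (nhds 0) := by
        simpa using hdel.const_mul (x 0 : ℝ)
      have hsm1 : ∀ᶠ m in atTop, (x 0 : ℝ) * |del (x m : ℝ)| < 1 / 3 :=
        hlim0.eventually_lt_const (by norm_num)
      have hsm2 : ∀ᶠ m in atTop, (x 0 : ℝ) * |del (x m : ℝ)| < 1 / ((j : ℝ) + 1) :=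
        hlim0.eventually_lt_const (by positivity)
      filter_upwards [hsm1, hsm2, hN (x 0).den] with m s1 s2 hm
      have hR : R = ∏ p ∈ (x 0).den.primeFactors, p := by
        have := hQ {0} (by simp)
        rw [Finset.sum_singleton] at this
        rw [hRdef, if_neg hq, this]
      have hdv : (((x 0).den : ℕ) : ℤ) ∣ rnd (x m : ℝ) := by
        refine dvd_trans ?_ hm
        rw [hR]
        exact_mod_cast dvd_rad_pow (x 0).den (Rat.den_ne_zero _)
      obtain ⟨w, hw⟩ := hdv
      have hx0 : (x 0 : ℝ) * ((x 0).den : ℝ) = ((x 0).num : ℝ) := by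
        exact_mod_cast Rat.mul_den_eq_num (x 0)
      have hprod : ((x 0 * x m : ℚ) : ℝ) = (((x 0).num * w : ℤ) : ℝ) + (x 0 : ℝ) * del (x m : ℝ) := by
        unfold del
        rw [hw]
        push_cast
        rw [← hx0]
        ring
      have p0 := hx2' 0
      have habs : |(x 0 : ℝ) * del (x m : ℝ)| = (x 0 : ℝ) * |del (x m : ℝ)| := by
        rw [abs_mul, abs_of_pos (by linarith)]
      have hd : del ((x 0 * x m : ℚ) : ℝ) = (x 0 : ℝ) * del (x m : ℝ) := by
        rw [hprod]; exact del_int_add _ _ (by rw [habs]; exact s1)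
      have hdne : del (x m : ℝ) ≠ 0 := fun h => hq ((hdenn m).1 (den_one_of_del _ h))
      have hne : (x 0 : ℝ) * del (x m : ℝ) ≠ 0 := mul_ne_zero (by positivity) hdne
      unfold gg
      rw [if_neg (fun h => hne (by rw [← hd]; exact del_of_den_one _ h)), hd, habs]
      have hpos : 0 < (x 0 : ℝ) * |del (x m : ℝ)| := by rw [← habs]; exact abs_pos.2 hne
      rw [lt_div_iff₀ (by positivity)] at s2
      rw [lt_div_iff₀ hpos]
      nlinarith
  obtain ⟨m, h1, h2, h3⟩ := (hgp.and (hmne.and (hA (j + 1)))).exists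
  have := h6p {0, m} (by simp)
  rw [haF _ (by simp), Finset.prod_pair h2.symm, Finset.sum_pair h2.symm,
    mult_add _ _ _ (fin2 _ (aa_pos _ (hx2 0)).ne') h3, ← hj] at this
  exact absurd (this.2 he6) (not_le.2 h1)

abbrev Col := ZMod 3 × ZMod 3 × Prop × Prop × Prop × Prop

noncomputable def col (x : ℚ) : Col :=
  ((kk (x : ℝ) : ZMod 3), (kk (Real.logb 2 (x : ℝ)) : ZMod 3), Even x.den.primeFactors.card,
    Even (multiplicity ((Rad x : ℕ) : ℤ) (rnd (x : ℝ))), Even (multiplicity (2 : ℤ) (aa x)),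
    gg x ≤ (multiplicity (2 : ℤ) (aa x) : ℝ))

lemma no_seq (x : ℕ → ℚ) (c : Col) (hub : ¬ ∃ C : ℚ, ∀ n, x n ≤ C)
    (hfin : {p : ℕ | p.Prime ∧ ∃ n, p ∣ (x n).den}.Finite)
    (hc : ∀ F : Finset ℕ, F.Nonempty → col (∑ i ∈ F, x i) = c ∧ col (∏ i ∈ F, x i) = c) : False := by
  have hub' : ¬ ∃ C : ℝ, ∀ n, (x n : ℝ) ≤ C := by
    rintro ⟨C, hC⟩
    obtain ⟨k, hk⟩ := exists_nat_ge C
    exact hub ⟨k, fun n => by exact_mod_cast (hC n).trans hk⟩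
  obtain ⟨φ, hφ, ht⟩ := unbdd_sub _ hub'
  obtain ⟨N, hN⟩ := eventually_atTop.1 (ht.eventually_ge_atTop 2)
  obtain ⟨ψ, hψ, b, hb⟩ := all_sub hfin.toFinset (fun p hp => ((Set.Finite.mem_toFinset hfin).1 hp).1)
    (fun n => x (φ (n + N)))
  set θ : ℕ → ℕ := fun n => φ (ψ n + N) with hθ
  have hθm : StrictMono θ := fun i j hij => hφ (by have := hψ hij; omega)
  have hc' : ∀ F : Finset ℕ, F.Nonempty →
      col (∑ i ∈ F, x (θ i)) = c ∧ col (∏ i ∈ F, x (θ i)) = c := by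
    intro F hF
    have := hc (F.map ⟨θ, hθm.injective⟩) (by simpa using hF)
    simpa using this
  have hcs := fun F hF => (hc' F hF).1
  have hcp := fun F hF => (hc' F hF).2
  obtain ⟨c1, c2, c3, c4, c5, c6⟩ := c
  simp only [col, Prod.mk.injEq] at hcs hcp
  obtain ⟨Q, hQ⟩ := primes_const hfin.toFinset
    (fun p hp => ((Set.Finite.mem_toFinset hfin).1 hp).1) (fun n => x (θ n)) b
    (fun n p hp hd => (Set.Finite.mem_toFinset hfin).2 ⟨hp, _, hd⟩) hb c3
    (fun F hF => iff_of_eq (hcs F hF).2.2.1)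
  have hz : ∀ (z : ℤ) (d : ZMod 3), (z : ZMod 3) = d → z % 3 = (d.val : ℤ) := by
    intro z d h
    rw [← h, ZMod.val_intCast]; rfl
  refine core (fun n => x (θ n)) ?_ ?_ Q hQ (c1.val) (c2.val) c4 c5 c6
    (fun F hF => hz _ _ (hcs F hF).1) (fun F hF => hz _ _ (hcs F hF).2.1)
    (fun F hF => hz _ _ (hcp F hF).2.1) (fun F hF => iff_of_eq (hcs F hF).2.2.2.1)
    (fun F hF => iff_of_eq (hcp F hF).2.2.2.2.1) (fun F hF => iff_of_eq (hcs F hF).2.2.2.2.2)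
    (fun F hF => iff_of_eq (hcp F hF).2.2.2.2.2)
  · intro n
    have := hN (ψ n + N) (by omega)
    simp only [Function.comp] at this
    exact_mod_cast this
  · have h1 : Tendsto (fun n => ψ n + N) atTop atTop :=
      tendsto_atTop_mono (fun n => (hψ.le_apply).trans (Nat.le_add_right _ _)) tendsto_id
    exact ht.comp h1

end FSP


/-- There exists a finite colouring `α` of the positive rationals such that there is no
unbounded injective sequence `(x_n)` of positive rationals whose terms' denominators
involve only finitely many primes and whose finite sums and finite products are all of
the same colour. -/
theorem stmt_10 :
    ∃ (r : ℕ) (α : ℚ → Fin r),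
      ¬ ∃ (x : ℕ → ℚ) (c : Fin r),
        Function.Injective x ∧ (∀ n, 0 < x n) ∧
        (¬ ∃ C : ℚ, ∀ n, x n ≤ C) ∧
        {p : ℕ | p.Prime ∧ ∃ n, p ∣ (x n).den}.Finite ∧
        (∀ F : Finset ℕ, F.Nonempty →
          α (∑ i ∈ F, x i) = c ∧ α (∏ i ∈ F, x i) = c) := by
  classical
  obtain ⟨r, ⟨f⟩⟩ := Finite.exists_equiv_fin FSP.Col
  refine ⟨r, fun x => f (FSP.col x), ?_⟩
  rintro ⟨x, c, -, -, hub, hfin, hc⟩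
  refine FSP.no_seq x (f.symm c) hub hfin (fun F hF => ?_)
  have := hc F hF
  exact ⟨(f.eq_symm_apply).2 this.1, (f.eq_symm_apply).2 this.2⟩
end

section
/- For every k ∈ ℕ there exists a finite colouring of ℚ_(k), the set of positive rationals whose denominators (in lowest terms) have all their prime factors among the first k primes, such that no injective sequence (x_n)_{n≥1} of elements of ℚ_(k) has the set of all its finite sums and finite products, namely {∑_{i∈F} x_i : F a finite nonempty set of indices} ∪ {∏_{i∈F} x_i : F a finite nonempty set of indices}, monochromatic. -/
/-- `ℚ_(k)`: positive rationals whose denominator (in lowest terms) has all its prime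
factors among the first `k` primes `p_1, …, p_k` (here `Nat.nth Nat.Prime j` is the
`(j+1)`-st prime). -/
def QQ (k : ℕ) : Set ℚ :=
  {x : ℚ | 0 < x ∧ ∀ p : ℕ, p.Prime → p ∣ x.den → ∃ j < k, p = Nat.nth Nat.Prime j}

open Filter in
theorem core12 (x : ℕ → ℚ) (v u : ℚ → ℕ)
    (hv : Function.Injective (fun n => v (x n)))
    (hu : ∀ n, n < u (x n))
    (hpv : ∀ i j, i ≠ j → v (x i * x j) = v (x i) + v (x j))
    (hpu : ∀ i j, i ≠ j → u (x i * x j) = u (x i) + u (x j))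
    (hsv : ∀ i, ∀ᶠ j in atTop, v (x i + x j) = v (x i))
    (hsu : ∀ i, ∀ᶠ j in atTop, u (x i + x j) = u (x j))
    (hc2 : ∀ i j, i ≠ j → padicValNat 2 (u (x i * x j)) % 2 = padicValNat 2 (u (x i)) % 2)
    (hc4 : ∀ i j, i ≠ j → (u (x i) / 2 ^ padicValNat 2 (u (x i))) % 4
      = (u (x j) / 2 ^ padicValNat 2 (u (x j))) % 4)
    (hB : ∀ i j, i ≠ j → (Nat.log 2 (v (x i + x j)) < padicValNat 2 (u (x i + x j)) ↔
      Nat.log 2 (v (x i * x j)) < padicValNat 2 (u (x i * x j)))) : False := by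
  have hpos : ∀ n, u (x n) ≠ 0 := fun n => by have := hu n; omega
  have hlow : Function.Injective (fun n => padicValNat 2 (u (x n))) := by
    intro i j hij
    by_contra hne
    simp only at hij
    have h2 := hc2 i j hne
    have h4 := hc4 i j hne
    rw [hpu i j hne] at h2
    rw [← hij] at h4
    obtain ⟨s, hs⟩ : 2 ^ padicValNat 2 (u (x i)) ∣ u (x i) := pow_padicValNat_dvd
    obtain ⟨t, ht⟩ : 2 ^ padicValNat 2 (u (x i)) ∣ u (x j) := by
      rw [hij]; exact pow_padicValNat_dvd
    have hs2 : ¬ 2 ∣ s := by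
      rintro ⟨w, rfl⟩
      apply pow_succ_padicValNat_not_dvd (p := 2) (hpos i)
      refine ⟨w, ?_⟩
      rw [pow_succ]; linarith
    set a := padicValNat 2 (u (x i)) with ha
    have hap : 0 < 2 ^ a := by positivity
    rw [hs, ht, Nat.mul_div_cancel_left _ hap, Nat.mul_div_cancel_left _ hap] at h4
    obtain ⟨w, hw⟩ : ∃ w, s + t = 2 * (2 * w + 1) := ⟨(s + t) / 4, by omega⟩
    have : u (x i) + u (x j) = 2 ^ (a + 1) * (2 * w + 1) := by
      rw [hs, ht, pow_succ, ← mul_add, hw]; ring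
    rw [this, padicValNat.mul (by positivity) (by omega), padicValNat.prime_pow,
      padicValNat.eq_zero_of_not_dvd (by omega : ¬ 2 ∣ 2 * w + 1)] at h2
    omega
  have hvT : Tendsto (fun n => v (x n)) atTop atTop := by
    rw [← Nat.cofinite_eq_atTop]; exact hv.tendsto_cofinite
  have hlT : Tendsto (fun n => padicValNat 2 (u (x n))) atTop atTop := by
    rw [← Nat.cofinite_eq_atTop]; exact hlow.tendsto_cofinite
  obtain ⟨j, h1, h2, h3, h4, h5, h6⟩ := ((eventually_gt_atTop 0).and <|
    (hsv 0).and <| (hsu 0).and <| (hlT.eventually_gt_atTop (Nat.log 2 (v (x 0)))).and <|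
    (hlT.eventually_gt_atTop (padicValNat 2 (u (x 0)))).and <|
    (hvT.eventually_ge_atTop (2 ^ (padicValNat 2 (u (x 0)))))).exists
  have h := (hB 0 j h1.ne).1 (by rw [h2, h3]; exact h4)
  rw [hpv 0 j h1.ne, hpu 0 j h1.ne] at h
  have e : padicValNat 2 (u (x 0) + u (x j)) ≤ padicValNat 2 (u (x 0)) := by
    by_contra hlt
    push Not at hlt
    have d1 : 2 ^ (padicValNat 2 (u (x 0)) + 1) ∣ u (x 0) + u (x j) :=
      (pow_dvd_pow 2 hlt).trans pow_padicValNat_dvd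
    have d2 : 2 ^ (padicValNat 2 (u (x 0)) + 1) ∣ u (x j) :=
      (pow_dvd_pow 2 h5).trans pow_padicValNat_dvd
    exact pow_succ_padicValNat_not_dvd (p := 2) (hpos 0) ((Nat.dvd_add_left d2).1 d1)
  have e2 : padicValNat 2 (u (x 0)) ≤ Nat.log 2 (v (x 0) + v (x j)) :=
    Nat.le_log_of_pow_le (by norm_num) (by omega)
  omega

noncomputable def mlow12 (x : ℚ) : Prop := (x / 2 ^ (Int.log 2 x)) ^ 2 < 2

open Classical in
noncomputable def ulog12 (x : ℚ) : ℕ :=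
  if mlow12 x then (Int.log 2 x).toNat else (Int.log 2 x).toNat + 1

noncomputable def vv12 (q : ℕ) (x : ℚ) : ℕ := (padicValRat q x).toNat

noncomputable def uu12 (p : ℕ) (x : ℚ) : ℕ := (- padicValRat p x).toNat

noncomputable def res12 (q : ℕ) [Fact q.Prime] (x : ℚ) : ZMod q :=
  ((x / (q : ℚ) ^ (padicValRat q x) : ℚ) : ZMod q)

theorem log_eq12 {x : ℚ} {f : ℤ} (h1 : (2 : ℚ) ^ f ≤ x) (h2 : x < 2 ^ (f + 1)) :
    Int.log 2 x = f := by
  have hx : 0 < x := lt_of_lt_of_le (by positivity) h1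
  apply le_antisymm
  · have := (Int.lt_zpow_iff_log_lt (b := 2) (by norm_num) (x := f + 1) hx).1 (by exact_mod_cast h2)
    omega
  · exact (Int.zpow_le_iff_le_log (b := 2) (by norm_num) hx).1 (by exact_mod_cast h1)

theorem mant12 {x : ℚ} (hx : 0 < x) : ∃ m : ℚ, 1 ≤ m ∧ m < 2 ∧ x = m * 2 ^ (Int.log 2 x) ∧
    (mlow12 x ↔ m ^ 2 < 2) := by
  have hp : (0 : ℚ) < 2 ^ (Int.log 2 x) := by positivity
  refine ⟨x / 2 ^ (Int.log 2 x), ?_, ?_, ?_, Iff.rfl⟩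
  · rw [le_div_iff₀ hp, one_mul]
    exact_mod_cast Int.zpow_log_le_self (b := 2) (by norm_num) hx
  · rw [div_lt_iff₀ hp, mul_comm, ← zpow_add_one₀ (by norm_num)]
    exact_mod_cast Int.lt_zpow_succ_log_self (b := 2) (by norm_num) x
  · field_simp

theorem mlow_iff12 {m : ℚ} {f : ℤ} (h1 : 1 ≤ m) (h2 : m < 2) :
    Int.log 2 (m * 2 ^ f) = f ∧ (mlow12 (m * 2 ^ f) ↔ m ^ 2 < 2) := by
  have hp : (0 : ℚ) < 2 ^ f := by positivity
  have : Int.log 2 (m * 2 ^ f) = f := by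
    apply log_eq12
    · nlinarith
    · rw [zpow_add_one₀ (by norm_num)]; nlinarith
  refine ⟨this, ?_⟩
  unfold mlow12
  rw [this, mul_div_cancel_right₀ _ hp.ne']

theorem ulog_mul12 {x y : ℚ} (hx : 1 ≤ x) (hy : 1 ≤ y) (h : mlow12 x ↔ mlow12 y)
    (h' : mlow12 (x * y) ↔ mlow12 x) : ulog12 (x * y) = ulog12 x + ulog12 y := by
  obtain ⟨m, m1, m2, hm, hml⟩ := mant12 (show 0 < x by linarith)
  obtain ⟨n, n1, n2, hn, hnl⟩ := mant12 (show 0 < y by linarith)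
  have fx : 0 ≤ Int.log 2 x := by
    exact (Int.zpow_le_iff_le_log (b := 2) (by norm_num) (by linarith)).1 (by simpa using hx)
  have fy : 0 ≤ Int.log 2 y := by
    exact (Int.zpow_le_iff_le_log (b := 2) (by norm_num) (by linarith)).1 (by simpa using hy)
  have e : x * y = (m * n) * 2 ^ (Int.log 2 x + Int.log 2 y) := by
    rw [zpow_add₀ (by norm_num)]
    conv_lhs => rw [hm, hn]
    ring
  have e' : x * y = (m * n / 2) * 2 ^ (Int.log 2 x + Int.log 2 y + 1) := by
    rw [e, zpow_add_one₀ (by norm_num)]; ring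
  unfold ulog12
  by_cases hc : mlow12 x
  · have a := hml.1 hc
    have b := hnl.1 (h.1 hc)
    have hmn : m * n < 2 := by nlinarith [sq_nonneg (m - n)]
    rw [if_pos hc, if_pos (h.1 hc), if_pos (h'.2 hc), e,
      (mlow_iff12 (by nlinarith) hmn).1]
    omega
  · have a : ¬ m ^ 2 < 2 := fun t => hc (hml.2 t)
    have b : ¬ n ^ 2 < 2 := fun t => hc (h.2 (hnl.2 t))
    push Not at a b
    have hmn : 2 ≤ m * n := by
      by_contra hh
      push Not at hh
      have : (m * n) ^ 2 < 4 := by nlinarith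
      have : 4 ≤ m ^ 2 * n ^ 2 := by nlinarith
      nlinarith
    rw [if_neg hc, if_neg (fun t => hc (h.2 t)), if_neg (fun t => hc (h'.1 t)), e',
      (mlow_iff12 (by linarith) (by nlinarith)).1]
    omega

theorem ulog_add12 {x y : ℚ} (hx : 0 < x) (hxy : 5 * x < y)
    (h' : mlow12 (x + y) ↔ mlow12 y) : ulog12 (x + y) = ulog12 y := by
  obtain ⟨n, n1, n2, hn, hnl⟩ := mant12 (show 0 < y by linarith)
  have hp : (0 : ℚ) < 2 ^ (Int.log 2 y) := by positivity
  obtain ⟨d, hd⟩ : ∃ d : ℚ, x = d * 2 ^ (Int.log 2 y) := ⟨x / 2 ^ (Int.log 2 y), by field_simp⟩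
  have hd0 : 0 < d := by
    by_contra hh; push Not at hh; nlinarith
  have hd1 : 5 * d < n := by
    by_contra hh; push Not at hh
    have := mul_le_mul_of_nonneg_right hh hp.le
    rw [← hn] at this; linarith
  have e : x + y = (d + n) * 2 ^ (Int.log 2 y) := by rw [add_mul, ← hd, ← hn]
  have e' : x + y = ((d + n) / 2) * 2 ^ (Int.log 2 y + 1) := by
    rw [e, zpow_add_one₀ (by norm_num)]; ring
  have key : Int.log 2 (x + y) = Int.log 2 y := by
    by_cases hc : d + n < 2
    · rw [e, (mlow_iff12 (by linarith) hc).1]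
    · exfalso
      push Not at hc
      have k := (mlow_iff12 (m := (d + n) / 2) (f := Int.log 2 y + 1) (by linarith) (by linarith)).2
      rw [← e'] at k
      have : n ^ 2 < 2 := hnl.1 (h'.1 (k.2 (by nlinarith)))
      nlinarith
  unfold ulog12
  rw [key]
  by_cases hc : mlow12 y
  · rw [if_pos hc, if_pos (h'.2 hc)]
  · rw [if_neg hc, if_neg (fun t => hc (h'.1 t))]

theorem res_two12 {q : ℕ} [Fact q.Prime] (hq : q ≠ 2) {x y : ℚ} (hx : 0 < x) (hy : 0 < y)
    (hv : padicValRat q x = padicValRat q y) (h1 : res12 q x = res12 q y)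
    (h2 : res12 q (x + y) = res12 q x) : False := by
  have hqp : q.Prime := Fact.out
  have hq0 : (q : ℚ) ≠ 0 := by exact_mod_cast hqp.ne_zero
  -- units
  have unit : ∀ z : ℚ, 0 < z → padicValRat q z = 0 → ((z.den : ℕ) : ZMod q) ≠ 0 ∧ (z : ZMod q) ≠ 0 := by
    intro z hz h0
    have hden : ¬ q ∣ z.den := by
      intro hd
      have hnum : ¬ (q : ℤ) ∣ z.num := by
        intro hn
        have := Nat.dvd_gcd (Int.natCast_dvd.1 hn) hd
        rw [z.reduced] at this
        exact hqp.one_lt.ne' (Nat.dvd_one.1 this)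
      have h3 : padicValInt q z.num = 0 := padicValInt.eq_zero_of_not_dvd hnum
      have h4 : 1 ≤ padicValNat q z.den := one_le_padicValNat_of_dvd z.den_ne_zero hd
      rw [padicValRat.eq_1, h3] at h0
      omega
    have hnum : ¬ (q : ℤ) ∣ z.num := by
      intro hn
      have h4 : padicValNat q z.den = 0 := padicValNat.eq_zero_of_not_dvd hden
      rw [padicValRat.eq_1, h4] at h0
      have h3 : 1 ≤ padicValNat q z.num.natAbs :=
        one_le_padicValNat_of_dvd (by simpa using hz.ne') (Int.natCast_dvd.1 hn)
      unfold padicValInt at h0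
      omega
    have a : ((z.den : ℕ) : ZMod q) ≠ 0 := by rwa [Ne, ZMod.natCast_eq_zero_iff]
    refine ⟨a, ?_⟩
    rw [Rat.cast_def]
    refine div_ne_zero ?_ a
    rwa [Ne, ZMod.intCast_zmod_eq_zero_iff_dvd]
  set a := padicValRat q x with ha
  have vz : ∀ z : ℚ, 0 < z → padicValRat q z = a → padicValRat q (z / (q : ℚ) ^ a) = 0 := by
    intro z hz h
    rw [padicValRat.div hz.ne' (by positivity), padicValRat.zpow, padicValRat.self hqp.one_lt, h]
    ring
  have hqpos : (0 : ℚ) < q := by exact_mod_cast hqp.pos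
  have ux := unit (x / (q : ℚ) ^ a) (by positivity) (vz x hx rfl)
  have uy := unit (y / (q : ℚ) ^ a) (by positivity) (vz y hy hv.symm)
  unfold res12 at h1 h2
  rw [← hv, ← ha] at h1
  rw [← ha] at h2
  have hs : (((x + y) / (q : ℚ) ^ a : ℚ) : ZMod q) =
      ((x / (q : ℚ) ^ a : ℚ) : ZMod q) + ((y / (q : ℚ) ^ a : ℚ) : ZMod q) := by
    rw [add_div, Rat.cast_add_of_ne_zero ux.1 uy.1]
  rw [← h1] at hs
  have h20 : (2 : ZMod q) ≠ 0 := by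
    intro h
    have : ((2 : ℕ) : ZMod q) = 0 := by exact_mod_cast h
    rw [ZMod.natCast_eq_zero_iff] at this
    exact hq ((Nat.prime_dvd_prime_iff_eq hqp Nat.prime_two).1 this)
  -- valuation of the sum is a
  have hva : padicValRat q (x + y) = a := by
    have hne : (((x + y) / (q : ℚ) ^ a : ℚ) : ZMod q) ≠ 0 := by
      rw [hs, ← two_mul]; exact mul_ne_zero h20 ux.2
    have hge : a ≤ padicValRat q (x + y) := by
      have := padicValRat.min_le_padicValRat_add (p := q) (q := x) (r := y) (by positivity)
      rwa [← hv, min_self, ← ha] at this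
    by_contra hcon
    have hgt : a < padicValRat q (x + y) := lt_of_le_of_ne hge (Ne.symm hcon)
    apply hne
    set z := (x + y) / (q : ℚ) ^ a with hz
    have hzp : 0 < z := by positivity
    have hzv : 0 < padicValRat q z := by
      rw [hz, padicValRat.div (by positivity) (by positivity), padicValRat.zpow,
        padicValRat.self hqp.one_lt]
      linarith
    have : (q : ℤ) ∣ z.num := by
      by_contra hnd
      rw [padicValRat.eq_1, padicValInt.eq_zero_of_not_dvd hnd] at hzv
      omega
    rw [Rat.cast_def, (ZMod.intCast_zmod_eq_zero_iff_dvd _ _).2 this, zero_div]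
  rw [hva, hs] at h2
  exact ux.2 (by simpa using h2)

open Filter in
theorem extr12 {α : Type*} [LinearOrder α] (f : ℕ → α) (g : ℕ → α)
    (h : ¬ BddAbove (Set.range f)) : ∃ φ : ℕ → ℕ, StrictMono φ ∧ ∀ n, g n < f (φ n) := by
  apply extraction_forall_of_frequently (P := fun n m => g n < f m)
  intro n hn
  apply h
  have : IsBoundedUnder (· ≤ ·) atTop f := ⟨g n, by
    rw [eventually_map]
    filter_upwards [hn] with m hm using not_lt.1 hm⟩
  exact this.bddAbove_range

noncomputable def U12 (k : ℕ) : Option (Fin k) → ℚ → ℕ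
  | none => ulog12
  | some j => uu12 (Nat.nth Nat.Prime j)

noncomputable def col12 (k q : ℕ) [Fact q.Prime] (x : ℚ) :
    ZMod q × Prop × (Option (Fin k) → ZMod 2 × ZMod 4 × Prop) :=
  (res12 q x, mlow12 x, fun o =>
    ((padicValNat 2 (U12 k o x) : ℕ), (U12 k o x / 2 ^ padicValNat 2 (U12 k o x) : ℕ),
      Nat.log 2 (vv12 q x) < padicValNat 2 (U12 k o x)))

open Filter in
theorem finish12 (k q : ℕ) [Fact q.Prime] (hq2 : q ≠ 2) (x : ℕ → ℚ)
    (hpos : ∀ n, 0 < x n) (hval : ∀ n, 0 ≤ padicValRat q (x n))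
    (c : ZMod q × Prop × (Option (Fin k) → ZMod 2 × ZMod 4 × Prop))
    (h0 : ∀ n, col12 k q (x n) = c)
    (hS : ∀ i j, i ≠ j → col12 k q (x i + x j) = c)
    (hP : ∀ i j, i ≠ j → col12 k q (x i * x j) = c)
    (o : Option (Fin k)) 
    (hu : ∀ n, n < U12 k o (x n))
    (hpu : ∀ i j, i ≠ j → U12 k o (x i * x j) = U12 k o (x i) + U12 k o (x j))
    (hsu : ∀ i, ∀ᶠ j in atTop, U12 k o (x i + x j) = U12 k o (x j)) : False := by
  have hv : Function.Injective (fun n => vv12 q (x n)) := by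
    intro i j hij
    by_contra hne
    have hi := hval i
    have hj := hval j
    simp only [vv12] at hij
    exact res_two12 hq2 (hpos i) (hpos j) (by omega)
      (congrArg Prod.fst ((h0 i).trans (h0 j).symm))
      (congrArg Prod.fst ((hS i j hne).trans (h0 i).symm))
  have hvT : Tendsto (fun n => vv12 q (x n)) atTop atTop := by
    rw [← Nat.cofinite_eq_atTop]; exact hv.tendsto_cofinite
  refine core12 x (vv12 q) (U12 k o) hv hu ?_ hpu ?_ hsu ?_ ?_ ?_
  · intro i j _
    have hi := hval i
    have hj := hval j
    simp only [vv12]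
    rw [padicValRat.mul (hpos i).ne' (hpos j).ne']
    omega
  · intro i
    filter_upwards [hvT.eventually_gt_atTop (vv12 q (x i))] with j hj
    simp only [vv12] at hj ⊢
    have := hpos i
    have := hpos j
    rw [padicValRat.add_eq_of_lt (by positivity) (hpos i).ne' (hpos j).ne' (by omega)]
  · intro i j hne
    have := congrArg (fun t => (t.2.2 o).1) ((hP i j hne).trans (h0 i).symm)
    exact (ZMod.natCast_eq_natCast_iff _ _ _).1 this
  · intro i j hne
    have := congrArg (fun t => (t.2.2 o).2.1) ((h0 i).trans (h0 j).symm)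
    exact (ZMod.natCast_eq_natCast_iff _ _ _).1 this
  · intro i j hne
    have := congrArg (fun t => (t.2.2 o).2.2) ((hS i j hne).trans (hP i j hne).symm)
    exact iff_of_eq this

theorem unb12 (k : ℕ) (x : ℕ → ℚ) (hinj : Function.Injective x) (hx : ∀ n, x n ∈ QQ k)
    (hb : ∀ j : Fin k, BddAbove (Set.range fun n => uu12 (Nat.nth Nat.Prime j) (x n))) :
    ¬ BddAbove (Set.range x) := by
  rintro ⟨M, hM⟩
  choose B hB using hb
  set D := ∏ j : Fin k, (Nat.nth Nat.Prime j) ^ B j with hD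
  have hden : ∀ n, (x n).den ∣ D := by
    intro n
    have hD0 : D ≠ 0 := Finset.prod_ne_zero_iff.2 fun j _ =>
      pow_ne_zero _ (Nat.prime_nth_prime j).ne_zero
    rw [← Nat.factorization_prime_le_iff_dvd (x n).den_ne_zero hD0]
    intro p hp
    by_cases hpd : p ∣ (x n).den
    · obtain ⟨j, hj, rfl⟩ := (hx n).2 p hp hpd
      have h1 : uu12 (Nat.nth Nat.Prime j) (x n) ≤ B ⟨j, hj⟩ := hB ⟨j, hj⟩ ⟨n, rfl⟩
      have hnum : ¬ ((Nat.nth Nat.Prime j : ℕ) : ℤ) ∣ (x n).num := by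
        intro hn
        have := Nat.dvd_gcd (Int.natCast_dvd.1 hn) hpd
        rw [(x n).reduced] at this
        exact hp.one_lt.ne' (Nat.dvd_one.1 this)
      unfold uu12 at h1
      rw [padicValRat.eq_1, padicValInt.eq_zero_of_not_dvd hnum] at h1
      rw [Nat.factorization_def _ hp]
      have h2 : (Nat.nth Nat.Prime j) ^ B ⟨j, hj⟩ ∣ D :=
        Finset.dvd_prod_of_mem (fun j : Fin k => (Nat.nth Nat.Prime j) ^ B j) (Finset.mem_univ (⟨j, hj⟩ : Fin k))
      have h3 := (hp.pow_dvd_iff_le_factorization hD0).1 h2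
      rw [Nat.factorization_def _ hp] at h3
      rw [Nat.factorization_def _ hp]
      omega
    · rw [Nat.factorization_eq_zero_of_not_dvd hpd]; exact Nat.zero_le _
  have hint : ∀ n, ∃ m : ℕ, x n * D = m := by
    intro n
    obtain ⟨e, he⟩ := hden n
    refine ⟨((x n).num * e).toNat, ?_⟩
    have hn : 0 ≤ (x n).num := (Rat.num_pos.2 (hx n).1).le
    have h1 : ((((x n).num * e).toNat : ℤ) : ℚ) = (((x n).num * e : ℤ) : ℚ) := by
      rw [Int.toNat_of_nonneg (by positivity)]
    rw [Int.cast_natCast] at h1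
    rw [h1, he]
    push_cast
    rw [← mul_assoc, Rat.mul_den_eq_num]
  choose m hm using hint
  have hD0 : (D : ℚ) ≠ 0 := by
    rw [hD]; exact_mod_cast Finset.prod_ne_zero_iff.2 fun (j : Fin k) _ =>
      pow_ne_zero (B j) (Nat.prime_nth_prime j).ne_zero
  have hminj : Function.Injective m := by
    intro i j hij
    apply hinj
    apply mul_right_cancel₀ hD0
    rw [hm, hm, hij]
  have hT : Filter.Tendsto m Filter.atTop Filter.atTop := by
    rw [← Nat.cofinite_eq_atTop]; exact hminj.tendsto_cofinite
  obtain ⟨n, hn⟩ := (hT.eventually_gt_atTop ⌈M * D⌉₊).exists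
  have h1 : x n ≤ M := hM ⟨n, rfl⟩
  have h2 : M * D ≤ ⌈M * D⌉₊ := Nat.le_ceil _
  have h3 : ((⌈M * D⌉₊ : ℕ) : ℚ) < m n := by exact_mod_cast hn
  rw [← hm] at h3
  have h4 : x n * D ≤ M * D := mul_le_mul_of_nonneg_right h1 (by positivity)
  linarith

open Filter in
theorem main12 (k q : ℕ) [Fact q.Prime] (hq2 : q ≠ 2) (hqk : ∀ j < k, q ≠ Nat.nth Nat.Prime j)
    (x : ℕ → ℚ) (hinj : Function.Injective x) (hx : ∀ n, x n ∈ QQ k)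
    (c : ZMod q × Prop × (Option (Fin k) → ZMod 2 × ZMod 4 × Prop))
    (h0 : ∀ n, col12 k q (x n) = c)
    (hS : ∀ i j, i ≠ j → col12 k q (x i + x j) = c)
    (hP : ∀ i j, i ≠ j → col12 k q (x i * x j) = c) : False := by
  have hqp : q.Prime := Fact.out
  have hval : ∀ n, 0 ≤ padicValRat q (x n) := by
    intro n
    have : ¬ q ∣ (x n).den := by
      intro hd
      obtain ⟨j, hj, h⟩ := (hx n).2 q hqp hd
      exact hqk j hj h
    rw [padicValRat.eq_1, padicValNat.eq_zero_of_not_dvd this]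
    simp
  by_cases hb : ∀ j : Fin k, BddAbove (Set.range fun n => uu12 (Nat.nth Nat.Prime j) (x n))
  · obtain ⟨φ, hφ, hlt⟩ := extr12 x (fun n => (2 : ℚ) ^ (n + 1)) (unb12 k x hinj hx hb)
    have hφi := hφ.injective
    have hone : ∀ n, 1 ≤ x (φ n) := fun n =>
      (one_le_pow₀ (by norm_num : (1 : ℚ) ≤ 2)).trans (hlt n).le
    have hT : Tendsto (fun n => x (φ n)) atTop atTop := by
      refine tendsto_atTop_mono (fun n => (hlt n).le) ?_
      exact (tendsto_pow_atTop_atTop_of_one_lt (by norm_num : (1 : ℚ) < 2)).comp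
        (tendsto_add_atTop_nat 1)
    refine finish12 k q hq2 (x ∘ φ) (fun n => (hx _).1) (fun n => hval _) c (fun n => h0 _)
      (fun i j h => hS _ _ (hφi.ne h)) (fun i j h => hP _ _ (hφi.ne h)) none ?_ ?_ ?_
    · intro n
      have : ((n + 1 : ℕ) : ℤ) ≤ Int.log 2 (x (φ n)) :=
        (Int.zpow_le_iff_le_log (b := 2) (by norm_num) (hx _).1).1
          (by rw [zpow_natCast]; exact_mod_cast (hlt n).le)
      simp only [U12, ulog12, Function.comp]
      split_ifs <;> omega
    · intro i j hne
      refine ulog_mul12 (hone i) (hone j) ?_ ?_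
      · exact iff_of_eq (congrArg (fun t => t.2.1) ((h0 (φ i)).trans (h0 (φ j)).symm))
      · exact iff_of_eq (congrArg (fun t => t.2.1)
          ((hP (φ i) (φ j) (hφi.ne hne)).trans (h0 (φ i)).symm))
    · intro i
      filter_upwards [hT.eventually_gt_atTop (5 * x (φ i)), eventually_gt_atTop i] with j hj hij
      refine ulog_add12 (hx _).1 hj ?_
      exact iff_of_eq (congrArg (fun t => t.2.1)
          ((hS (φ i) (φ j) (hφi.ne hij.ne)).trans (h0 (φ j)).symm))
  · push Not at hb
    obtain ⟨r, hr⟩ := hb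
    have : Fact (Nat.nth Nat.Prime r).Prime := ⟨Nat.prime_nth_prime r⟩
    obtain ⟨φ, hφ, hlt⟩ := extr12 _ (fun n => n) hr
    have hφi := hφ.injective
    refine finish12 k q hq2 (x ∘ φ) (fun n => (hx _).1) (fun n => hval _) c (fun n => h0 _)
      (fun i j h => hS _ _ (hφi.ne h)) (fun i j h => hP _ _ (hφi.ne h)) (some r) hlt ?_ ?_
    · intro i j hne
      have hi := hlt i
      have hj := hlt j
      simp only [U12, uu12, Function.comp] at hi hj ⊢
      rw [padicValRat.mul (hx _).1.ne' (hx _).1.ne']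
      omega
    · intro i
      filter_upwards [eventually_gt_atTop (uu12 (Nat.nth Nat.Prime r) (x (φ i)))] with j hj
      have hj' := hlt j
      simp only [U12, uu12, Function.comp] at hj hj' ⊢
      have := (hx (φ i)).1
      have := (hx (φ j)).1
      rw [add_comm, padicValRat.add_eq_of_lt (by positivity) (hx _).1.ne' (hx _).1.ne' (by omega)]

/-- For every `k` there is a finite colouring of `ℚ_(k)` such that no injective sequence
of elements of `ℚ_(k)` has the set of all its finite sums and finite products
monochromatic. -/
theorem stmt_12 (k : ℕ) :
    ∃ (r : ℕ) (χ : ℚ → Fin r),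
      ¬ ∃ (x : ℕ → ℚ) (c : Fin r),
        Function.Injective x ∧ (∀ n, x n ∈ QQ k) ∧
        (∀ F : Finset ℕ, F.Nonempty →
          χ (∑ i ∈ F, x i) = c ∧ χ (∏ i ∈ F, x i) = c) := by
  have : Fact (Nat.nth Nat.Prime (k + 1)).Prime := ⟨Nat.prime_nth_prime _⟩
  set q := Nat.nth Nat.Prime (k + 1) with hq
  have hq2 : q ≠ 2 := by
    have h1 : Nat.nth Nat.Prime 0 < Nat.nth Nat.Prime (k + 1) :=
      Nat.nth_strictMono Nat.infinite_setOfPred_prime (by omega)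
    have h2 := (Nat.prime_nth_prime 0).two_le
    omega
  have hqk : ∀ j < k, q ≠ Nat.nth Nat.Prime j := by
    intro j hj
    exact (Nat.nth_strictMono Nat.infinite_setOfPred_prime (show j < k + 1 by omega)).ne'
  obtain ⟨r, ⟨e⟩⟩ := Finite.exists_equiv_fin
    (ZMod q × Prop × (Option (Fin k) → ZMod 2 × ZMod 4 × Prop))
  refine ⟨r, fun x => e (col12 k q x), ?_⟩
  rintro ⟨x, c, hinj, hx, h⟩
  refine main12 k q hq2 hqk x hinj hx (e.symm c) ?_ ?_ ?_
  · intro n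
    rw [Equiv.eq_symm_apply]
    simpa using (h {n} (by simp)).1
  · intro i j hne
    rw [Equiv.eq_symm_apply]
    simpa [Finset.sum_pair hne] using (h {i, j} (by simp)).1
  · intro i j hne
    rw [Equiv.eq_symm_apply]
    simpa [Finset.prod_pair hne] using (h {i, j} (by simp)).2
end
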